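/- arXiv:2011.11884 — 4 statements merged into one kernel-verified Lean document; each statement's English description precedes it below -/
import Mathlib

section
/- Under assumptions (a)–(c) and the SMG iterates with arbitrary permutations, suppose additionally that η_0 := η_1, η_t ≥ η_{t+1} for 1 ≤ t ≤ T−1, and 0 < η_t ≤ 1/(L·√K) for all t ∈ {1,…,T}, where K := max{5/2, 9(5−3β)(Θ+1)/(1−β)}. Then (1/Σ_{t=1}^T η_t) · Σ_{t=1}^T η_t·‖∇F(w̃_{t−1})‖² ≤ 4·(F(w̃_0) − F_*)/((1−β)·Σ_{t=1}^T η_t) + (9·σ²·L²·(5−3β)/(1−β)) · (Σ_{t=1}^T η_{t−1}³)/(Σ_{t=1}^T η_t). -/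
open Finset

lemma norm_sq_add_three_le {E : Type*} [NormedAddCommGroup E] (a b c : E) :
    ‖a + b + c‖ ^ 2 ≤ 3 * (‖a‖ ^ 2 + ‖b‖ ^ 2 + ‖c‖ ^ 2) := by
  have h2 := pow_le_pow_left₀ (norm_nonneg _) (norm_add₃_le (a := a) (b := b) (c := c)) 2
  nlinarith [sq_nonneg (‖a‖ - ‖b‖), sq_nonneg (‖a‖ - ‖c‖), sq_nonneg (‖b‖ - ‖c‖)]

section InnerProduct

variable {E : Type*} [NormedAddCommGroup E] [InnerProductSpace ℝ E]

/-- The square of the norm is convex. -/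
lemma norm_sq_convex_comb_le (β : ℝ) (h0 : 0 ≤ β) (h1 : β ≤ 1) (a b : E) :
    ‖β • a + (1 - β) • b‖ ^ 2 ≤ β * ‖a‖ ^ 2 + (1 - β) * ‖b‖ ^ 2 := by
  have h : ‖β • a + (1 - β) • b‖ ≤ β * ‖a‖ + (1 - β) * ‖b‖ := by
    refine (norm_add_le _ _).trans ?_
    rw [norm_smul, norm_smul, Real.norm_of_nonneg h0, Real.norm_of_nonneg (sub_nonneg.2 h1)]
  have h2 := pow_le_pow_left₀ (norm_nonneg _) h 2
  nlinarith [mul_nonneg (mul_nonneg h0 (sub_nonneg.2 h1)) (sq_nonneg (‖a‖ - ‖b‖))]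

/-- A partial sum of `n` vectors, divided by `n`, is bounded by the quadratic mean of all. -/
lemma norm_sq_inv_smul_sum_le {n : ℕ} (hn : 1 ≤ n) (u : ℕ → E) (s : Finset ℕ)
    (hs : s ⊆ range n) :
    ‖(n : ℝ)⁻¹ • ∑ j ∈ s, u j‖ ^ 2 ≤ (n : ℝ)⁻¹ * ∑ j ∈ range n, ‖u j‖ ^ 2 := by
  have hn0 : (0 : ℝ) < n := by exact_mod_cast hn
  have h1 : ‖∑ j ∈ s, u j‖ ≤ ∑ j ∈ range n, ‖u j‖ :=
    (norm_sum_le _ _).trans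
      (sum_le_sum_of_subset_of_nonneg hs fun _ _ _ => norm_nonneg _)
  have h2 := sq_sum_le_card_mul_sum_sq (s := range n) (f := fun j => ‖u j‖)
  rw [card_range] at h2
  rw [norm_smul, mul_pow, Real.norm_of_nonneg (by positivity)]
  calc (n : ℝ)⁻¹ ^ 2 * ‖∑ j ∈ s, u j‖ ^ 2
      ≤ (n : ℝ)⁻¹ ^ 2 * (n * ∑ j ∈ range n, ‖u j‖ ^ 2) := by
        gcongr
        exact (pow_le_pow_left₀ (norm_nonneg _) h1 2).trans h2
    _ = _ := by field_simp

lemma inner_loop_sub {n : ℕ} {η : ℝ} {u w : ℕ → E}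
    (hw : ∀ i < n, w (i + 1) = w i - (η / (n : ℝ)) • u i) {i k : ℕ} (hik : i ≤ k) (hk : k ≤ n) :
    w k - w i = (-η) • ((n : ℝ)⁻¹ • ∑ j ∈ Ico i k, u j) := by
  rw [← sum_Ico_sub w hik, smul_smul, smul_sum]
  refine sum_congr rfl fun j hj => ?_
  rw [hw j ((mem_Ico.1 hj).2.trans_le hk), sub_sub_cancel_left, ← neg_smul, div_eq_mul_inv,
    neg_mul]

/-- Displacement of an inner loop with steps `-(η / n) • (β • m₀ + (1 - β) • g i)` between any two
inner indices. -/
lemma norm_sq_inner_loop_le {n : ℕ} (hn : 1 ≤ n) {β η : ℝ} (h0 : 0 ≤ β) (h1 : β ≤ 1)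
    {m₀ : E} {g w : ℕ → E}
    (hw : ∀ i < n, w (i + 1) = w i - (η / (n : ℝ)) • (β • m₀ + (1 - β) • g i))
    {i k : ℕ} (hik : i ≤ k) (hk : k ≤ n) :
    ‖w k - w i‖ ^ 2
      ≤ η ^ 2 * (β * ‖m₀‖ ^ 2 + (1 - β) * ((n : ℝ)⁻¹ * ∑ j ∈ range n, ‖g j‖ ^ 2)) := by
  have hn0 : (0 : ℝ) < n := by exact_mod_cast hn
  have hsub : Ico i k ⊆ range n := fun j hj => mem_range.2 ((mem_Ico.1 hj).2.trans_le hk)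
  rw [inner_loop_sub hw hik hk, norm_smul, mul_pow, norm_neg, Real.norm_eq_abs, sq_abs]
  refine mul_le_mul_of_nonneg_left ?_ (sq_nonneg _)
  refine (norm_sq_inv_smul_sum_le hn _ _ hsub).trans ?_
  calc (n : ℝ)⁻¹ * ∑ j ∈ range n, ‖β • m₀ + (1 - β) • g j‖ ^ 2
      ≤ (n : ℝ)⁻¹ * ∑ j ∈ range n, (β * ‖m₀‖ ^ 2 + (1 - β) * ‖g j‖ ^ 2) := by
        gcongr
        exact norm_sq_convex_comb_le β h0 h1 _ _
    _ = _ := by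
        rw [sum_add_distrib, sum_const, card_range, ← mul_sum, nsmul_eq_mul]
        field_simp

lemma inv_mul_sum_range_le {n : ℕ} (hn : 1 ≤ n) {a : ℕ → ℝ} {C : ℝ} (h : ∀ i < n, a i ≤ C) :
    (n : ℝ)⁻¹ * ∑ i ∈ range n, a i ≤ C := by
  have hn0 : (0 : ℝ) < n := by exact_mod_cast hn
  have := sum_le_card_nsmul (range n) a C fun i hi => h i (mem_range.1 hi)
  rw [card_range, nsmul_eq_mul] at this
  rwa [inv_mul_le_iff₀ hn0]

variable [CompleteSpace E]

/-- A descent inequality for a function with Lipschitz gradient. -/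
lemma le_add_inner_gradient_add_sq {F : E → ℝ} {L : ℝ} (hF : Differentiable ℝ F) (hL : 0 ≤ L)
    (hs : ∀ x y, ‖gradient F x - gradient F y‖ ≤ L * ‖x - y‖) (x y : E) :
    F y ≤ F x + inner ℝ (gradient F x) (y - x) + L * ‖y - x‖ ^ 2 := by
  have hb : ∀ z ∈ segment ℝ x y, ‖fderiv ℝ F z - fderiv ℝ F x‖ ≤ L * ‖y - x‖ := by
    intro z hz
    have h1 : ‖fderiv ℝ F z - fderiv ℝ F x‖ = ‖gradient F z - gradient F x‖ := by
      rw [gradient, gradient, ← map_sub, LinearIsometryEquiv.norm_map]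
    rw [h1]
    exact (hs z x).trans (mul_le_mul_of_nonneg_left (norm_sub_le_of_mem_segment hz) hL)
  have h := (convex_segment x y).norm_image_sub_le_of_norm_fderiv_le' (𝕜 := ℝ)
    (fun z _ => hF z) hb (left_mem_segment ℝ x y) (right_mem_segment ℝ x y)
  have h2 := (le_abs_self _).trans h
  have h3 : fderiv ℝ F x (y - x) = inner ℝ (gradient F x) (y - x) := by
    rw [gradient, InnerProductSpace.toDual_symm_apply]
  rw [h3] at h2
  nlinarith

/-- One inexact gradient step with direction `u` decreases `F` up to the direction error. -/
lemma descent_of_step {F : E → ℝ} {L η : ℝ} (hF : Differentiable ℝ F) (hL : 0 ≤ L)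
    (hs : ∀ x y, ‖gradient F x - gradient F y‖ ≤ L * ‖x - y‖) (hη : 0 ≤ η)
    (hηL : 2 * (L * η) ≤ 1) (x u : E) :
    F (x - η • u) ≤ F x - η / 2 * ‖gradient F x‖ ^ 2 + η / 2 * ‖gradient F x - u‖ ^ 2 := by
  have h := le_add_inner_gradient_add_sq hF hL hs x (x - η • u)
  rw [sub_sub_cancel_left, inner_neg_right, inner_smul_right, norm_neg, norm_smul, mul_pow,
    Real.norm_of_nonneg hη] at h
  rw [norm_sub_sq_real]
  nlinarith [mul_nonneg (mul_nonneg hη (sub_nonneg.2 hηL)) (sq_nonneg ‖u‖)]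

end InnerProduct

section FiniteSum

variable {E : Type*} [NormedAddCommGroup E] [InnerProductSpace ℝ E] [CompleteSpace E]
  {n : ℕ} {f : Fin n → E → ℝ}

lemma hasGradientAt_mean (hf : ∀ i, Differentiable ℝ (f i)) (x : E) :
    HasGradientAt (fun x => (1 / (n : ℝ)) * ∑ i, f i x)
      ((n : ℝ)⁻¹ • ∑ i, gradient (f i) x) x := by
  rw [hasGradientAt_iff_hasFDerivAt, map_smul, map_sum]
  simp only [one_div]
  refine HasFDerivAt.const_mul (HasFDerivAt.fun_sum fun i _ => ?_) _
  exact ((hf i) x).hasGradientAt.hasFDerivAt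

lemma gradient_mean_perm (hf : ∀ i, Differentiable ℝ (f i)) (p : Equiv.Perm (Fin n)) (x : E) :
    gradient (fun x => (1 / (n : ℝ)) * ∑ i, f i x) x
      = (n : ℝ)⁻¹ • ∑ i, gradient (f (p i)) x := by
  rw [(hasGradientAt_mean hf x).gradient, Equiv.sum_comp p fun i => gradient (f i) x]

/-- The mean of component gradients taken at shifted points, against the full gradient. -/
lemma norm_sq_gradient_mean_sub_le (hn : 1 ≤ n) (hf : ∀ i, Differentiable ℝ (f i)) {L C : ℝ}
    (hs : ∀ i x y, ‖gradient (f i) x - gradient (f i) y‖ ≤ L * ‖x - y‖)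
    (p : Equiv.Perm (Fin n)) {g w : ℕ → E}
    (hg : ∀ i, ∀ hi : i < n, g i = gradient (f (p ⟨i, hi⟩)) (w i)) (x : E)
    (hw : ∀ i < n, ‖x - w i‖ ^ 2 ≤ C) :
    ‖gradient (fun x => (1 / (n : ℝ)) * ∑ i, f i x) x - (n : ℝ)⁻¹ • ∑ i ∈ range n, g i‖ ^ 2
      ≤ L ^ 2 * C := by
  let h : ℕ → E := fun i => if hi : i < n then gradient (f (p ⟨i, hi⟩)) x else 0
  have hh : ∑ i, gradient (f (p i)) x = ∑ i ∈ range n, h i := by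
    rw [sum_range]
    exact sum_congr rfl fun i _ => by simp [h]
  rw [gradient_mean_perm hf p, hh, ← smul_sub, ← sum_sub_distrib]
  refine (norm_sq_inv_smul_sum_le hn _ _ subset_rfl).trans ?_
  refine inv_mul_sum_range_le hn fun i hi => ?_
  simp only [h, dif_pos hi, hg i hi]
  refine (pow_le_pow_left₀ (norm_nonneg _) (hs _ _ _) 2).trans ?_
  rw [mul_pow]
  exact mul_le_mul_of_nonneg_left (hw i hi) (sq_nonneg _)

lemma lipschitz_gradient_mean (hn : 1 ≤ n) (hf : ∀ i, Differentiable ℝ (f i)) {L : ℝ}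
    (hs : ∀ i x y, ‖gradient (f i) x - gradient (f i) y‖ ≤ L * ‖x - y‖) (x y : E) :
    ‖gradient (fun x => (1 / (n : ℝ)) * ∑ i, f i x) x
      - gradient (fun x => (1 / (n : ℝ)) * ∑ i, f i x) y‖ ≤ L * ‖x - y‖ := by
  have hn0 : (0 : ℝ) < n := by exact_mod_cast hn
  rw [(hasGradientAt_mean hf x).gradient, (hasGradientAt_mean hf y).gradient, ← smul_sub,
    ← sum_sub_distrib, norm_smul, Real.norm_of_nonneg (by positivity), inv_mul_le_iff₀ hn0]
  refine (norm_sum_le _ _).trans ((sum_le_card_nsmul _ _ _ fun i _ => hs i x y).trans ?_)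
  simp

/-- Second moment of component gradients taken at points near `x`. -/
lemma mean_norm_sq_gradient_le (hn : 1 ≤ n) {F : E → ℝ} {L C Θ σ : ℝ}
    (hs : ∀ i x y, ‖gradient (f i) x - gradient (f i) y‖ ≤ L * ‖x - y‖)
    (p : Equiv.Perm (Fin n)) {g w : ℕ → E}
    (hg : ∀ i, ∀ hi : i < n, g i = gradient (f (p ⟨i, hi⟩)) (w i)) (x : E)
    (hvar : (1 / (n : ℝ)) * ∑ i, ‖gradient (f i) x - gradient F x‖ ^ 2
        ≤ Θ * ‖gradient F x‖ ^ 2 + σ ^ 2)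
    (hw : ∀ i < n, ‖w i - x‖ ^ 2 ≤ C) :
    (n : ℝ)⁻¹ * ∑ i ∈ range n, ‖g i‖ ^ 2
      ≤ 3 * ((Θ + 1) * ‖gradient F x‖ ^ 2 + σ ^ 2) + 3 * (L ^ 2 * C) := by
  have hn0 : (0 : ℝ) < n := by exact_mod_cast hn
  have hterm : ∀ i : Fin n, ‖g i‖ ^ 2
      ≤ 3 * (L ^ 2 * C + ‖gradient (f (p i)) x - gradient F x‖ ^ 2 + ‖gradient F x‖ ^ 2) := by
    intro i
    have h1 : g i = (gradient (f (p i)) (w i) - gradient (f (p i)) x)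
        + (gradient (f (p i)) x - gradient F x) + gradient F x := by
      rw [hg i i.2]; abel
    have h2 : ‖gradient (f (p i)) (w i) - gradient (f (p i)) x‖ ^ 2 ≤ L ^ 2 * C := by
      refine (pow_le_pow_left₀ (norm_nonneg _) (hs _ _ _) 2).trans ?_
      rw [mul_pow]
      exact mul_le_mul_of_nonneg_left (hw i i.2) (sq_nonneg _)
    rw [h1]
    exact (norm_sq_add_three_le _ _ _).trans (by linarith)
  have hsum := sum_le_sum fun i (_ : i ∈ (univ : Finset (Fin n))) => hterm i
  rw [← mul_sum, sum_add_distrib, sum_add_distrib,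
    Equiv.sum_comp p fun i => ‖gradient (f i) x - gradient F x‖ ^ 2, sum_const, sum_const,
    card_univ, Fintype.card_fin, nsmul_eq_mul, nsmul_eq_mul] at hsum
  rw [sum_range, inv_mul_le_iff₀ hn0]
  rw [one_div, inv_mul_le_iff₀ hn0] at hvar
  linarith

end FiniteSum

/-- Summation of the epoch-wise estimates: `Φ` are function values, `Y` squared gradient norms,
`P` second moments of the stochastic gradients, indexed by `s = t - 1`. -/
lemma sum_le_of_epoch_estimates {T : ℕ} (hT : 1 ≤ T) {β L Θ σ : ℝ} (hβ0 : 0 ≤ β) (hβ1 : β < 1)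
    (hΘ : 0 ≤ Θ) {η Φ Y P : ℕ → ℝ}
    (hη : ∀ t < T, 0 < η t) (hdec : ∀ t, t + 1 < T → η (t + 1) ≤ η t)
    (hq : ∀ t < T, 9 * (5 - 3 * β) * (Θ + 1) * (L ^ 2 * η t ^ 2) ≤ 1 - β)
    (hY : ∀ t, 0 ≤ Y t) (hP : ∀ t, 0 ≤ P t) (hP0 : P 0 = 0)
    (hPle : ∀ t < T, P (t + 1) ≤ 3 * ((Θ + 1) * Y t + σ ^ 2)
      + 3 * (L ^ 2 * (η t ^ 2 * (β * P t + (1 - β) * P (t + 1)))))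
    (hΦ0 : Φ 1 ≤ Φ 0 - η 0 / 2 * Y 0 + η 0 / 2 * (β * Y 0
      + (1 - β) * (L ^ 2 * (η 0 ^ 2 * (β * P 0 + (1 - β) * P 1)))))
    (hΦ : ∀ t, t + 1 < T → Φ (t + 2) ≤ Φ (t + 1) - η (t + 1) / 2 * Y (t + 1)
      + η (t + 1) / 2 * (β * (L ^ 2 * (η t ^ 2 * (β * P t + (1 - β) * P (t + 1))))
        + (1 - β) * (L ^ 2 * (η (t + 1) ^ 2 * (β * P (t + 1) + (1 - β) * P (t + 2)))))) :
    (1 - β) / 4 * ∑ t ∈ range T, η t * Y t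
      ≤ Φ 0 - Φ T + 9 / 4 * (5 - 3 * β) * (σ ^ 2 * L ^ 2) * ∑ t ∈ range T, η t ^ 3 := by
  have hb : 0 < 1 - β := sub_pos.2 hβ1
  set D : ℕ → ℝ := fun t => β * P t + (1 - β) * P (t + 1) with hD
  have hDn : ∀ t, 0 ≤ D t := fun t => add_nonneg (mul_nonneg hβ0 (hP _)) (mul_nonneg hb.le (hP _))
  have hqs : ∀ t < T, 45 * (L ^ 2 * η t ^ 2) ≤ 1 := by
    intro t ht
    have h0 : 0 ≤ L ^ 2 * η t ^ 2 := by positivity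
    have h1 : 9 * (5 - 3 * β) * (L ^ 2 * η t ^ 2) ≤ 1 - β := by
      refine le_trans ?_ (hq t ht)
      have : 0 ≤ (9 * (5 - 3 * β) * (L ^ 2 * η t ^ 2)) * Θ :=
        mul_nonneg (mul_nonneg (by linarith) h0) hΘ
      nlinarith
    nlinarith
  have hcube : ∀ t, t + 1 < T → η (t + 1) ^ 3 ≤ η t ^ 3 := fun t ht =>
    pow_le_pow_left₀ (hη _ ht).le (hdec t ht) 3
  have htel : ∀ k, k + 1 ≤ T → Φ (k + 1) + ∑ t ∈ range (k + 1), η t / 2 * Y t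
      ≤ Φ 0 + β * (η 0 / 2 * Y 0) + L ^ 2 / 2 * ∑ t ∈ range (k + 1), η t ^ 3 * D t
        - β * (L ^ 2 / 2 * (η k ^ 3 * D k)) := by
    intro k
    induction k with
    | zero =>
      intro _
      simp only [zero_add, sum_range_one]
      simp only [hD, zero_add]
      linarith
    | succ k ih =>
      intro hk
      have h1 := ih (by omega)
      have h2 := hΦ k (by omega)
      rw [sum_range_succ _ (k + 1), sum_range_succ (fun t => η t ^ 3 * D t) (k + 1)]
      have h3 : η (k + 1) * (β * (L ^ 2 * (η k ^ 2 * D k)))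
          ≤ η k * (β * (L ^ 2 * (η k ^ 2 * D k))) :=
        mul_le_mul_of_nonneg_right (hdec k (by omega))
          (mul_nonneg hβ0 (mul_nonneg (sq_nonneg _) (mul_nonneg (sq_nonneg _) (hDn k))))
      have h4 : D (k + 1) = β * P (k + 1) + (1 - β) * P (k + 2) := rfl
      rw [← h4] at h2
      change Φ (k + 2) ≤ Φ (k + 1) - η (k + 1) / 2 * Y (k + 1)
        + η (k + 1) / 2 * (β * (L ^ 2 * (η k ^ 2 * D k))
          + (1 - β) * (L ^ 2 * (η (k + 1) ^ 2 * D (k + 1)))) at h2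
      have h5 : Φ (k + 1 + 1) = Φ (k + 2) := rfl
      rw [h5]
      linarith
  have hDP : ∀ k, k + 1 ≤ T → ∑ t ∈ range (k + 1), η t ^ 3 * D t
      ≤ ∑ t ∈ range (k + 1), η t ^ 3 * P (t + 1) - β * (η k ^ 3 * P (k + 1)) := by
    intro k
    induction k with
    | zero =>
      intro _
      simp only [zero_add, sum_range_one, hD, hP0]
      linarith
    | succ k ih =>
      intro hk
      have h1 := ih (by omega)
      rw [sum_range_succ _ (k + 1), sum_range_succ (fun t => η t ^ 3 * P (t + 1)) (k + 1)]
      have h2 : η (k + 1) ^ 3 * (β * P (k + 1)) ≤ η k ^ 3 * (β * P (k + 1)) :=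
        mul_le_mul_of_nonneg_right (hcube k (by omega)) (mul_nonneg hβ0 (hP _))
      simp only [hD] at h1 ⊢
      linarith
  have hPS : ∑ t ∈ range T, η t ^ 3 * P (t + 1)
      ≤ 3 * ∑ t ∈ range T, η t ^ 3 * ((Θ + 1) * Y t + σ ^ 2)
        + 1 / 15 * ∑ t ∈ range T, η t ^ 3 * D t := by
    rw [mul_sum, mul_sum, ← sum_add_distrib]
    refine sum_le_sum fun t ht => ?_
    have ht := mem_range.1 ht
    have h1 : P (t + 1) ≤ 3 * ((Θ + 1) * Y t + σ ^ 2) + 1 / 15 * D t := by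
      have h2 := hPle t ht
      have h3 := mul_le_mul_of_nonneg_right (hqs t ht) (hDn t)
      simp only [hD] at h3 ⊢
      linarith
    have h4 := mul_le_mul_of_nonneg_left h1 (pow_nonneg (hη t ht).le 3)
    linarith
  have hYsum : L ^ 2 * ∑ t ∈ range T, η t ^ 3 * ((Θ + 1) * Y t + σ ^ 2)
      ≤ (1 - β) / 18 * ∑ t ∈ range T, η t * Y t
        + σ ^ 2 * L ^ 2 * ∑ t ∈ range T, η t ^ 3 := by
    rw [mul_sum, mul_sum, mul_sum, ← sum_add_distrib]
    refine sum_le_sum fun t ht => ?_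
    have ht := mem_range.1 ht
    have h0 : 0 ≤ (Θ + 1) * (L ^ 2 * η t ^ 2) := by positivity
    have h1 : (Θ + 1) * (L ^ 2 * η t ^ 2) ≤ (1 - β) / 18 := by
      have := hq t ht
      nlinarith [mul_nonneg h0 hb.le]
    have h2 := mul_le_mul_of_nonneg_right h1 (mul_nonneg (hη t ht).le (hY t))
    linarith
  have hfirst : η 0 * Y 0 ≤ ∑ t ∈ range T, η t * Y t :=
    single_le_sum (f := fun t => η t * Y t)
      (fun t ht => mul_nonneg (hη t (mem_range.1 ht)).le (hY t)) (mem_range.2 hT)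
  obtain ⟨k, rfl⟩ : ∃ k, T = k + 1 := ⟨T - 1, by omega⟩
  have h1 := htel k le_rfl
  have h2 := hDP k le_rfl
  have hηk := (hη k (Nat.lt_succ_self k)).le
  have h3 : 0 ≤ β * (η k ^ 3 * P (k + 1)) := mul_nonneg hβ0 (mul_nonneg (pow_nonneg hηk 3) (hP _))
  have h4 : 0 ≤ β * (L ^ 2 / 2 * (η k ^ 3 * D k)) :=
    mul_nonneg hβ0 (mul_nonneg (by positivity) (mul_nonneg (pow_nonneg hηk 3) (hDn _)))
  have hhalf : ∑ t ∈ range (k + 1), η t / 2 * Y t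
      = 1 / 2 * ∑ t ∈ range (k + 1), η t * Y t := by
    rw [mul_sum]
    exact sum_congr rfl fun t _ => by ring
  rw [hhalf] at h1
  have hZ : 0 ≤ σ ^ 2 * L ^ 2 * ∑ t ∈ range (k + 1), η t ^ 3 :=
    mul_nonneg (by positivity) (sum_nonneg fun t ht => pow_nonneg (hη t (mem_range.1 ht)).le 3)
  have hA : 0 ≤ ∑ t ∈ range (k + 1), η t * Y t :=
    sum_nonneg fun t ht => mul_nonneg (hη t (mem_range.1 ht)).le (hY t)
  generalize ∑ t ∈ range (k + 1), η t * Y t = A at *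
  generalize ∑ t ∈ range (k + 1), η t ^ 3 * D t = B at *
  generalize ∑ t ∈ range (k + 1), η t ^ 3 * P (t + 1) = Q at *
  generalize ∑ t ∈ range (k + 1), η t ^ 3 * ((Θ + 1) * Y t + σ ^ 2) = S at *
  generalize ∑ t ∈ range (k + 1), η t ^ 3 = Z at *
  have h5 : B ≤ 45 / 14 * S := by linarith
  have h6 : L ^ 2 * B ≤ 45 / 14 * (L ^ 2 * S) := by
    have := mul_le_mul_of_nonneg_left h5 (sq_nonneg L)
    linarith
  have h7 := mul_le_mul_of_nonneg_left hfirst hβ0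
  have h8 := mul_nonneg hb.le hZ
  have h9 := mul_nonneg hb.le hA
  linarith



theorem smg_main_theorem
    (n d : ℕ) (hn : 1 ≤ n) (hd : 1 ≤ d)
    (f : Fin n → EuclideanSpace ℝ (Fin d) → ℝ)
    (hf : ∀ i, Differentiable ℝ (f i))
    (F : EuclideanSpace ℝ (Fin d) → ℝ)
    (hF : F = fun x => (1 / (n : ℝ)) * ∑ i, f i x)
    (L : ℝ) (hL : 0 < L)
    (hsmooth : ∀ i x y, ‖gradient (f i) x - gradient (f i) y‖ ≤ L * ‖x - y‖)
    (Θ σ : ℝ) (hΘ : 0 ≤ Θ) (hσ : 0 ≤ σ)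
    (hvar : ∀ x, (1 / (n : ℝ)) * ∑ i, ‖gradient (f i) x - gradient F x‖ ^ 2
        ≤ Θ * ‖gradient F x‖ ^ 2 + σ ^ 2)
    (Fstar : ℝ) (hFstar : IsGLB (Set.range F) Fstar)
    (T : ℕ) (hT : 1 ≤ T)
    (β : ℝ) (hβ0 : 0 ≤ β) (hβ1 : β < 1)
    (η : ℕ → ℝ) (hηpos : ∀ t, 1 ≤ t → t ≤ T → 0 < η t)
    (π : ℕ → Equiv.Perm (Fin n))
    (w m v g : ℕ → ℕ → EuclideanSpace ℝ (Fin d))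
    (wt mt : ℕ → EuclideanSpace ℝ (Fin d))
    (hmt0 : mt 0 = 0)
    (hw0 : ∀ t, 1 ≤ t → t ≤ T → w t 0 = wt (t - 1))
    (hm0 : ∀ t, 1 ≤ t → t ≤ T → m t 0 = mt (t - 1))
    (hv0 : ∀ t, 1 ≤ t → t ≤ T → v t 0 = 0)
    (hg : ∀ t, 1 ≤ t → t ≤ T → ∀ i, ∀ hi : i < n,
        g t i = gradient (f (π t ⟨i, hi⟩)) (w t i))
    (hm1 : ∀ t, 1 ≤ t → t ≤ T → ∀ i, i < n →
        m t (i + 1) = β • m t 0 + (1 - β) • g t i)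
    (hv1 : ∀ t, 1 ≤ t → t ≤ T → ∀ i, i < n →
        v t (i + 1) = v t i + ((n : ℝ))⁻¹ • g t i)
    (hw1 : ∀ t, 1 ≤ t → t ≤ T → ∀ i, i < n →
        w t (i + 1) = w t i - (η t / (n : ℝ)) • m t (i + 1))
    (hwt : ∀ t, 1 ≤ t → t ≤ T → wt t = w t n)
    (hmt : ∀ t, 1 ≤ t → t ≤ T → mt t = v t n)
    (K : ℝ) (hKdef : K = max (5 / 2) (9 * (5 - 3 * β) * (Θ + 1) / (1 - β)))
    (hη0 : η 0 = η 1)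
    (hηdec : ∀ t, 1 ≤ t → t ≤ T - 1 → η (t + 1) ≤ η t)
    (hηK : ∀ t, 1 ≤ t → t ≤ T → η t ≤ 1 / (L * Real.sqrt K)) :
    (∑ t ∈ Icc 1 T, η t * ‖gradient F (wt (t - 1))‖ ^ 2) / (∑ t ∈ Icc 1 T, η t)
      ≤ 4 * (F (wt 0) - Fstar) / ((1 - β) * ∑ t ∈ Icc 1 T, η t)
        + 9 * σ ^ 2 * L ^ 2 * (5 - 3 * β) / (1 - β)
          * ((∑ t ∈ Icc 1 T, η (t - 1) ^ 3) / (∑ t ∈ Icc 1 T, η t)) := by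
  have hn0 : (0 : ℝ) < n := by exact_mod_cast hn
  have hb : 0 < 1 - β := sub_pos.2 hβ1
  have hFd : Differentiable ℝ F := by
    rw [hF]
    exact fun x => (hasGradientAt_mean hf x).hasFDerivAt.differentiableAt
  have hFs : ∀ x y, ‖gradient F x - gradient F y‖ ≤ L * ‖x - y‖ := by
    rw [hF]
    exact lipschitz_gradient_mean hn hf hsmooth
  have hq : ∀ t, 1 ≤ t → t ≤ T → 9 * (5 - 3 * β) * (Θ + 1) * (L ^ 2 * η t ^ 2) ≤ 1 - β := by
    intro t h1 h2
    have hK : 9 * (5 - 3 * β) * (Θ + 1) ≤ K * (1 - β) := by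
      rw [← div_le_iff₀ hb, hKdef]
      exact le_max_right _ _
    have hK0 : 0 < K := by
      rw [hKdef]
      exact lt_of_lt_of_le (by norm_num) (le_max_left _ _)
    have h3 := hηK t h1 h2
    rw [le_div_iff₀ (mul_pos hL (Real.sqrt_pos.2 hK0))] at h3
    have h4 := pow_le_pow_left₀
      (mul_nonneg (hηpos t h1 h2).le (mul_pos hL (Real.sqrt_pos.2 hK0)).le) h3 2
    rw [mul_pow, mul_pow, Real.sq_sqrt hK0.le] at h4
    have h5 := mul_le_mul_of_nonneg_right hK (by positivity : 0 ≤ L ^ 2 * η t ^ 2)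
    have h6 := mul_le_mul_of_nonneg_right h4 hb.le
    linarith
  have hLη : ∀ t, 1 ≤ t → t ≤ T → 2 * (L * η t) ≤ 1 := by
    intro t h1 h2
    have h3 := hq t h1 h2
    have h4 : 0 ≤ L ^ 2 * η t ^ 2 := by positivity
    have h5 : 0 ≤ (5 - 3 * β) * (L ^ 2 * η t ^ 2) * Θ :=
      mul_nonneg (mul_nonneg (by linarith) h4) hΘ
    have h6 : 9 * (5 - 3 * β) * (L ^ 2 * η t ^ 2) ≤ 1 - β := by nlinarith
    have h7 : (2 * (L * η t)) ^ 2 ≤ 1 := by nlinarith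
    nlinarith
  have hv : ∀ t, 1 ≤ t → t ≤ T → mt t = (n : ℝ)⁻¹ • ∑ i ∈ range n, g t i := by
    intro t h1 h2
    have : ∀ i ≤ n, v t i = (n : ℝ)⁻¹ • ∑ j ∈ range i, g t j := by
      intro i
      induction i with
      | zero => intro _; simp [hv0 t h1 h2]
      | succ i ih =>
        intro hi
        rw [hv1 t h1 h2 i hi, ih (by omega), sum_range_succ, smul_add]
    rw [hmt t h1 h2, this n le_rfl]
  set P : ℕ → ℝ := fun t => if t = 0 then 0 else (n : ℝ)⁻¹ * ∑ i ∈ range n, ‖g t i‖ ^ 2 with hPdef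
  have hPs : ∀ t, P (t + 1) = (n : ℝ)⁻¹ * ∑ i ∈ range n, ‖g (t + 1) i‖ ^ 2 := fun t => by
    simp [hPdef]
  have hPn : ∀ t, 0 ≤ P t := by
    intro t
    simp only [hPdef]
    split_ifs <;> positivity
  have hmP : ∀ t ≤ T, ‖mt t‖ ^ 2 ≤ P t := by
    intro t ht
    rcases t with _ | t
    · simp [hmt0, hPdef]
    · rw [hPs, hv (t + 1) (by omega) ht]
      exact norm_sq_inv_smul_sum_le hn _ _ subset_rfl
  have hstep : ∀ t, t < T → ∀ i < n, w (t + 1) (i + 1) = w (t + 1) i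
      - (η (t + 1) / (n : ℝ)) • (β • mt t + (1 - β) • g (t + 1) i) := by
    intro t ht i hi
    rw [hw1 _ (by omega) ht i hi, hm1 _ (by omega) ht i hi, hm0 _ (by omega) ht]
    rfl
  have hdisp : ∀ t, t < T → ∀ i k, i ≤ k → k ≤ n → ‖w (t + 1) k - w (t + 1) i‖ ^ 2
      ≤ η (t + 1) ^ 2 * (β * P t + (1 - β) * P (t + 1)) := by
    intro t ht i k hik hk
    refine (norm_sq_inner_loop_le hn hβ0 hβ1.le (hstep t ht) hik hk).trans ?_
    rw [← hPs]
    exact mul_le_mul_of_nonneg_left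
      (add_le_add_left (mul_le_mul_of_nonneg_left (hmP t ht.le) hβ0) _) (sq_nonneg _)
  have hstart : ∀ t, t < T → w (t + 1) 0 = wt t := fun t ht => hw0 (t + 1) (by omega) ht
  have hepoch : ∀ t, t < T →
      wt (t + 1) = wt t - η (t + 1) • (β • mt t + (1 - β) • mt (t + 1)) := by
    intro t ht
    have h1 := inner_loop_sub (hstep t ht) (Nat.zero_le n) le_rfl
    rw [← range_eq_Ico, sum_add_distrib, ← smul_sum, ← smul_sum, sum_const, card_range,
      ← Nat.cast_smul_eq_nsmul ℝ, smul_add, smul_comm _ β, inv_smul_smul₀ hn0.ne',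
      smul_comm _ (1 - β),
      ← hv (t + 1) (by omega) ht, hstart t ht, ← hwt (t + 1) (by omega) ht, sub_eq_iff_eq_add',
      neg_smul, ← sub_eq_add_neg] at h1
    exact h1
  have hdesc : ∀ t, t < T → F (wt (t + 1)) ≤ F (wt t) - η (t + 1) / 2 * ‖gradient F (wt t)‖ ^ 2
      + η (t + 1) / 2 * (β * ‖gradient F (wt t) - mt t‖ ^ 2
        + (1 - β) * ‖gradient F (wt t) - mt (t + 1)‖ ^ 2) := by
    intro t ht
    have hpos := (hηpos (t + 1) (by omega) ht).le
    have h1 := descent_of_step hFd hL.le hFs hpos (hLη (t + 1) (by omega) ht) (wt t)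
      (β • mt t + (1 - β) • mt (t + 1))
    have h2 : gradient F (wt t) - (β • mt t + (1 - β) • mt (t + 1))
        = β • (gradient F (wt t) - mt t) + (1 - β) • (gradient F (wt t) - mt (t + 1)) := by
      module
    rw [← hepoch t ht, h2] at h1
    have h3 := mul_le_mul_of_nonneg_left (norm_sq_convex_comb_le β hβ0 hβ1.le
      (gradient F (wt t) - mt t) (gradient F (wt t) - mt (t + 1))) (half_pos
        (hηpos (t + 1) (by omega) ht)).le
    linarith
  have hcur : ∀ t, t < T → ‖gradient F (wt t) - mt (t + 1)‖ ^ 2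
      ≤ L ^ 2 * (η (t + 1) ^ 2 * (β * P t + (1 - β) * P (t + 1))) := by
    intro t ht
    rw [hv (t + 1) (by omega) ht, hF]
    refine norm_sq_gradient_mean_sub_le hn hf hsmooth (π (t + 1)) (hg (t + 1) (by omega) ht) _
      fun i hi => ?_
    rw [norm_sub_rev, ← hstart t ht]
    exact hdisp t ht 0 i (Nat.zero_le _) hi.le
  have hprev : ∀ t, t < T → ‖gradient F (wt (t + 1)) - mt (t + 1)‖ ^ 2
      ≤ L ^ 2 * (η (t + 1) ^ 2 * (β * P t + (1 - β) * P (t + 1))) := by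
    intro t ht
    rw [hv (t + 1) (by omega) ht, hF]
    refine norm_sq_gradient_mean_sub_le hn hf hsmooth (π (t + 1)) (hg (t + 1) (by omega) ht) _
      fun i hi => ?_
    rw [hwt (t + 1) (by omega) ht]
    exact hdisp t ht i n hi.le le_rfl
  have hmain := sum_le_of_epoch_estimates hT (L := L) (Θ := Θ) (σ := σ) hβ0 hβ1 hΘ
    (η := fun t => η (t + 1)) (Φ := fun t => F (wt t)) (Y := fun t => ‖gradient F (wt t)‖ ^ 2)
    (P := P) (fun t ht => hηpos (t + 1) (by omega) ht)
    (fun t ht => hηdec (t + 1) (by omega) (by omega)) (fun t ht => hq (t + 1) (by omega) ht)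
    (fun t => sq_nonneg _) hPn (by simp [hPdef])
    (fun t ht => by
      rw [hPs]
      refine mean_norm_sq_gradient_le hn hsmooth (π (t + 1)) (hg (t + 1) (by omega) ht) _
        (hvar _) fun i hi => ?_
      rw [← hPs, ← hstart t ht]
      exact hdisp t ht 0 i (Nat.zero_le _) hi.le)
    (by
      have h1 := hdesc 0 hT
      have h2 := mul_le_mul_of_nonneg_left (hcur 0 hT)
        (mul_nonneg (half_pos (hηpos 1 le_rfl hT)).le hb.le)
      rw [hmt0, sub_zero] at h1
      simp only [zero_add] at h1 h2 ⊢
      linarith)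
    (fun t ht => by
      have h1 := hdesc (t + 1) ht
      have hpos := (half_pos (hηpos (t + 1 + 1) (by omega) ht)).le
      have h2 := mul_le_mul_of_nonneg_left (hcur (t + 1) ht) (mul_nonneg hpos hb.le)
      have h3 := mul_le_mul_of_nonneg_left (hprev t (by omega)) (mul_nonneg hpos hβ0)
      simp only [add_assoc, Nat.reduceAdd] at h1 h2 h3 ⊢
      linarith)
  have hlow : Fstar ≤ F (wt T) := hFstar.1 ⟨_, rfl⟩
  have hIcc : ∀ a : ℕ → ℝ, ∑ t ∈ Icc 1 T, a t = ∑ t ∈ range T, a (t + 1) := by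
    intro a
    rw [range_eq_Ico, sum_Ico_add' a 0 T 1]
    rfl
  have hcubes : ∑ t ∈ range T, η (t + 1) ^ 3 ≤ ∑ t ∈ range T, η t ^ 3 := by
    refine sum_le_sum fun t ht => ?_
    have ht := mem_range.1 ht
    refine pow_le_pow_left₀ (hηpos (t + 1) (by omega) ht).le ?_ 3
    rcases t with _ | t
    · exact hη0.ge
    · exact hηdec (t + 1) (by omega) (by omega)
  have hS : 0 < ∑ t ∈ range T, η (t + 1) :=
    sum_pos (fun t ht => hηpos (t + 1) (by omega) (mem_range.1 ht)) ⟨0, mem_range.2 hT⟩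
  rw [hIcc, hIcc, hIcc]
  simp only [Nat.add_sub_cancel]
  have hcoef : 0 ≤ 9 / 4 * (5 - 3 * β) * (σ ^ 2 * L ^ 2) :=
    mul_nonneg (by linarith) (by positivity)
  have hfin := mul_le_mul_of_nonneg_left hcubes hcoef
  generalize ∑ t ∈ range T, η (t + 1) = S at *
  generalize ∑ t ∈ range T, η (t + 1) * ‖gradient F (wt t)‖ ^ 2 = A at *
  have hrhs : 4 * (F (wt 0) - Fstar) / ((1 - β) * S)
      + 9 * σ ^ 2 * L ^ 2 * (5 - 3 * β) / (1 - β) * ((∑ t ∈ range T, η t ^ 3) / S)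
      = ((4 * (F (wt 0) - Fstar) + 9 * σ ^ 2 * L ^ 2 * (5 - 3 * β) * ∑ t ∈ range T, η t ^ 3)
        / (1 - β)) / S := by
    field_simp
  rw [hrhs]
  refine div_le_div_of_nonneg_right ?_ hS.le
  rw [le_div_iff₀ hb]
  linarith
end

section
/- Under assumptions (a)–(c) and the SMG iterates with arbitrary permutations, fix T ≥ 1 and choose the constant learning rate η_t := γ/T^{1/3} for some γ > 0 such that γ/T^{1/3} ≤ 1/(L·√K), where K := max{5/2, 9(5−3β)(Θ+1)/(1−β)}. Then (1/Σ_{t=1}^T η_t) · Σ_{t=1}^T η_t·‖∇F(w̃_{t−1})‖² ≤ (1/T^{2/3}) · ( 4·(F(w̃_0) − F_*)/((1−β)·γ) + 9·σ²·(5−3β)·L²·γ²/(1−β) ). -/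
open Finset

section SMG

variable {E : Type*} [NormedAddCommGroup E]

lemma norm_sum_sq_le_card_mul_sum {ι : Type*} (s : Finset ι) (v : ι → E) :
    ‖∑ i ∈ s, v i‖ ^ 2 ≤ (#s : ℝ) * ∑ i ∈ s, ‖v i‖ ^ 2 :=
  (pow_le_pow_left₀ (norm_nonneg _) (norm_sum_le _ _) 2).trans sq_sum_le_card_mul_sum_sq

lemma norm_add_add_sq_le (x y z : E) :
    ‖x + y + z‖ ^ 2 ≤ 3 * (‖x‖ ^ 2 + ‖y‖ ^ 2 + ‖z‖ ^ 2) := by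
  have h2 := pow_le_pow_left₀ (norm_nonneg _) (norm_add₃_le (a := x) (b := y) (c := z)) 2
  nlinarith [sq_nonneg (‖x‖ - ‖y‖), sq_nonneg (‖x‖ - ‖z‖), sq_nonneg (‖y‖ - ‖z‖)]

variable [InnerProductSpace ℝ E]

lemma norm_convex_comb_sq_le (x y : E) {β : ℝ} (h0 : 0 ≤ β) (h1 : β ≤ 1) :
    ‖β • x + (1 - β) • y‖ ^ 2 ≤ β * ‖x‖ ^ 2 + (1 - β) * ‖y‖ ^ 2 := by
  have hn : ‖β • x + (1 - β) • y‖ ≤ β * ‖x‖ + (1 - β) * ‖y‖ := by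
    refine (norm_add_le _ _).trans_eq ?_
    rw [norm_smul, norm_smul, Real.norm_of_nonneg h0, Real.norm_of_nonneg (sub_nonneg.2 h1)]
  have h2 := pow_le_pow_left₀ (norm_nonneg _) hn 2
  nlinarith [mul_nonneg (mul_nonneg h0 (sub_nonneg.2 h1)) (sq_nonneg (‖x‖ - ‖y‖))]

/-- Within one epoch, the mean squared drift of the iterates `u i` from a reference point `r`
controls the error of the averaged gradient, and itself satisfies a recursive bound. -/
lemma exists_drift_bound {n : ℕ} (hn : 1 ≤ n) {u g ψ : ℕ → E} {r G M : E} {η L β V : ℝ}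
    (hβ0 : 0 ≤ β) (hβ1 : β ≤ 1)
    (hlip : ∀ j < n, ‖g j - ψ j‖ ≤ L * ‖u j - r‖)
    (hG : G = (n : ℝ)⁻¹ • ∑ j ∈ range n, ψ j)
    (hV : (n : ℝ)⁻¹ * ∑ j ∈ range n, ‖ψ j - G‖ ^ 2 ≤ V)
    (hS : ∀ i < n, ∃ S ⊆ range n,
      ‖u i - r‖ ≤ η / n * ‖∑ j ∈ S, (β • M + (1 - β) • g j)‖) :
    ∃ b, 0 ≤ b ∧ ‖(n : ℝ)⁻¹ • ∑ j ∈ range n, g j - G‖ ^ 2 ≤ b ∧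
      b ≤ η ^ 2 * L ^ 2 * (β * ‖M‖ ^ 2 + 3 * (1 - β) * (b + V + ‖G‖ ^ 2)) := by
  have hnpos : (0 : ℝ) < n := by exact_mod_cast hn
  have hs : 0 ≤ 1 - β := by linarith
  set b : ℝ := L ^ 2 * ((n : ℝ)⁻¹ * ∑ i ∈ range n, ‖u i - r‖ ^ 2) with hb
  have herr : (n : ℝ)⁻¹ * ∑ j ∈ range n, ‖g j - ψ j‖ ^ 2 ≤ b := by
    have : ∑ j ∈ range n, ‖g j - ψ j‖ ^ 2 ≤ L ^ 2 * ∑ i ∈ range n, ‖u i - r‖ ^ 2 := by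
      rw [mul_sum]
      refine sum_le_sum fun j hj => ?_
      rw [← mul_pow]
      exact pow_le_pow_left₀ (norm_nonneg _) (hlip j (mem_range.1 hj)) 2
    calc _ ≤ (n : ℝ)⁻¹ * (L ^ 2 * ∑ i ∈ range n, ‖u i - r‖ ^ 2) := by gcongr
      _ = b := by rw [hb]; ring
  refine ⟨b, by positivity, ?_, ?_⟩
  · have h1 : (n : ℝ)⁻¹ • ∑ j ∈ range n, g j - G
        = (n : ℝ)⁻¹ • ∑ j ∈ range n, (g j - ψ j) := by
      rw [hG, sum_sub_distrib, smul_sub]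
    have h2 := norm_sum_sq_le_card_mul_sum (range n) fun j => g j - ψ j
    rw [card_range] at h2
    rw [h1, norm_smul, mul_pow, Real.norm_of_nonneg (by positivity)]
    calc _ ≤ (n : ℝ)⁻¹ ^ 2 * (n * ∑ j ∈ range n, ‖g j - ψ j‖ ^ 2) := by gcongr
      _ = (n : ℝ)⁻¹ * ∑ j ∈ range n, ‖g j - ψ j‖ ^ 2 := by field_simp
      _ ≤ b := herr
  · have hgsq : (n : ℝ)⁻¹ * ∑ j ∈ range n, ‖g j‖ ^ 2 ≤ 3 * (b + V + ‖G‖ ^ 2) := by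
      have h1 : ∑ j ∈ range n, ‖g j‖ ^ 2 ≤ 3 * (∑ j ∈ range n, ‖g j - ψ j‖ ^ 2
          + ∑ j ∈ range n, ‖ψ j - G‖ ^ 2 + n * ‖G‖ ^ 2) := by
        calc _ ≤ ∑ j ∈ range n, 3 * (‖g j - ψ j‖ ^ 2 + ‖ψ j - G‖ ^ 2 + ‖G‖ ^ 2) := by
              refine sum_le_sum fun j _ => ?_
              simpa using norm_add_add_sq_le (g j - ψ j) (ψ j - G) G
          _ = _ := by
              rw [← mul_sum, sum_add_distrib, sum_add_distrib, sum_const, card_range,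
                nsmul_eq_mul]
      calc _ ≤ (n : ℝ)⁻¹ * (3 * (∑ j ∈ range n, ‖g j - ψ j‖ ^ 2
          + ∑ j ∈ range n, ‖ψ j - G‖ ^ 2 + n * ‖G‖ ^ 2)) := by gcongr
        _ = 3 * ((n : ℝ)⁻¹ * ∑ j ∈ range n, ‖g j - ψ j‖ ^ 2
          + (n : ℝ)⁻¹ * ∑ j ∈ range n, ‖ψ j - G‖ ^ 2 + ‖G‖ ^ 2) := by field_simp
        _ ≤ _ := by gcongr
    have hdist : ∀ i ∈ range n, ‖u i - r‖ ^ 2 ≤ η ^ 2 * (β * ‖M‖ ^ 2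
        + (1 - β) * ((n : ℝ)⁻¹ * ∑ j ∈ range n, ‖g j‖ ^ 2)) := by
      intro i hi
      obtain ⟨S, hSn, hSi⟩ := hS i (mem_range.1 hi)
      have hcard : (#S : ℝ) ≤ n := by
        exact_mod_cast (card_le_card hSn).trans_eq (card_range n)
      calc ‖u i - r‖ ^ 2 ≤ (η / n * ‖∑ j ∈ S, (β • M + (1 - β) • g j)‖) ^ 2 := by gcongr
        _ = (η / n) ^ 2 * ‖∑ j ∈ S, (β • M + (1 - β) • g j)‖ ^ 2 := by ring
        _ ≤ (η / n) ^ 2 * (#S * ∑ j ∈ S, ‖β • M + (1 - β) • g j‖ ^ 2) := by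
            gcongr
            exact norm_sum_sq_le_card_mul_sum _ _
        _ ≤ (η / n) ^ 2 * (n * ∑ j ∈ range n, ‖β • M + (1 - β) • g j‖ ^ 2) := by
            gcongr
        _ ≤ (η / n) ^ 2 * (n * ∑ j ∈ range n, (β * ‖M‖ ^ 2 + (1 - β) * ‖g j‖ ^ 2)) := by
            gcongr
            exact norm_convex_comb_sq_le _ _ hβ0 hβ1
        _ = _ := by
            rw [sum_add_distrib, sum_const, card_range, nsmul_eq_mul, ← mul_sum]
            field_simp
    have hsum := sum_le_sum hdist
    rw [sum_const, card_range, nsmul_eq_mul] at hsum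
    calc b ≤ L ^ 2 * ((n : ℝ)⁻¹ * (n * (η ^ 2 * (β * ‖M‖ ^ 2
        + (1 - β) * ((n : ℝ)⁻¹ * ∑ j ∈ range n, ‖g j‖ ^ 2))))) := by rw [hb]; gcongr
      _ = η ^ 2 * L ^ 2 * (β * ‖M‖ ^ 2
        + (1 - β) * ((n : ℝ)⁻¹ * ∑ j ∈ range n, ‖g j‖ ^ 2)) := by field_simp
      _ ≤ η ^ 2 * L ^ 2 * (β * ‖M‖ ^ 2 + (1 - β) * (3 * (b + V + ‖G‖ ^ 2))) := by gcongr
      _ = _ := by ring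

/-- Iterates inside an epoch, in closed form. -/
lemma iterate_eq_sub_sum {n : ℕ} {u p : ℕ → E} {c : ℝ}
    (hu : ∀ i < n, u (i + 1) = u i - c • p i) {i : ℕ} (hi : i ≤ n) :
    u i = u 0 - c • ∑ j ∈ range i, p j := by
  induction i with
  | zero => simp
  | succ k ih =>
    rw [hu k hi, ih (Nat.le_of_succ_le hi), sum_range_succ, smul_add]
    abel

/-- The effect of one epoch of SMG with incoming momentum `M`. -/
lemma epoch_estimates {n : ℕ} (hn : 1 ≤ n) {φ : ℕ → E → E} {G : E → E} {u : ℕ → E} {M M' : E}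
    {η L β Θ σ : ℝ} (hβ0 : 0 ≤ β) (hβ1 : β ≤ 1) (hη : 0 ≤ η)
    (hlip : ∀ j < n, ∀ x y, ‖φ j x - φ j y‖ ≤ L * ‖x - y‖)
    (hG : ∀ x, G x = (n : ℝ)⁻¹ • ∑ j ∈ range n, φ j x)
    (hvar : ∀ x, (n : ℝ)⁻¹ * ∑ j ∈ range n, ‖φ j x - G x‖ ^ 2 ≤ Θ * ‖G x‖ ^ 2 + σ ^ 2)
    (hu : ∀ i < n, u (i + 1) = u i - (η / n) • (β • M + (1 - β) • φ i (u i)))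
    (hM' : M' = (n : ℝ)⁻¹ • ∑ j ∈ range n, φ j (u j)) :
    u n = u 0 - η • (β • M + (1 - β) • M') ∧
    ∀ r, r = u 0 ∨ r = u n → ∃ b, 0 ≤ b ∧ ‖M' - G r‖ ^ 2 ≤ b ∧
      b ≤ η ^ 2 * L ^ 2 *
        (β * ‖M‖ ^ 2 + 3 * (1 - β) * (b + (Θ * ‖G r‖ ^ 2 + σ ^ 2) + ‖G r‖ ^ 2)) := by
  have hnpos : (0 : ℝ) < n := by exact_mod_cast hn
  have hc : 0 ≤ η / n := by positivity
  have hclosed := fun i (hi : i ≤ n) => iterate_eq_sub_sum hu hi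
  constructor
  · rw [hclosed n le_rfl, sum_add_distrib, sum_const, card_range, ← smul_sum, hM',
      ← Nat.cast_smul_eq_nsmul ℝ]
    congr 1
    simp only [smul_add, smul_smul]
    congr 2 <;> field_simp
  · intro r hr
    rw [hM']
    refine exists_drift_bound hn hβ0 hβ1 (u := u) (r := r)
      (fun j hj => hlip j hj _ _) (hG r) (hvar r) fun i hi => ?_
    rcases hr with rfl | rfl
    · refine ⟨range i, range_subset_range.2 hi.le, ?_⟩
      rw [hclosed i hi.le, sub_sub_cancel_left, norm_neg, norm_smul, Real.norm_of_nonneg hc]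
    · refine ⟨Ico i n, fun j hj => mem_range.2 (mem_Ico.1 hj).2, ?_⟩
      rw [hclosed i hi.le, hclosed n le_rfl, sub_sub_sub_cancel_left, ← smul_sub,
        ← sum_Ico_eq_sub _ hi.le, norm_smul, Real.norm_of_nonneg hc]

/-- A function whose gradient is `L`-Lipschitz lies below its quadratic upper model. -/
lemma le_quadratic_of_lipschitz_gradient [CompleteSpace E] {F : E → ℝ} {G : E → E} {L : ℝ}
    (hF : ∀ x, HasGradientAt F (G x) x) (hG : ∀ x y, ‖G x - G y‖ ≤ L * ‖x - y‖) (x y : E) :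
    F y ≤ F x + inner ℝ (G x) (y - x) + L / 2 * ‖y - x‖ ^ 2 := by
  set h : ℝ → ℝ := fun t => F (x + t • (y - x)) - t * inner ℝ (G x) (y - x)
    - L / 2 * ‖y - x‖ ^ 2 * t ^ 2 with hh
  have hd : ∀ t, HasDerivAt h (inner ℝ (G (x + t • (y - x))) (y - x)
      - inner ℝ (G x) (y - x) - L / 2 * ‖y - x‖ ^ 2 * (2 * t)) t := by
    intro t
    have hline : HasDerivAt (fun t : ℝ => x + t • (y - x)) (y - x) t := by
      simpa using ((hasDerivAt_id t).smul_const (y - x)).const_add x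
    have h1 := (hF (x + t • (y - x))).hasFDerivAt.comp_hasDerivAt t hline
    have h2 := (hasDerivAt_id t).mul_const (inner ℝ (G x) (y - x))
    have h3 := ((hasDerivAt_id t).pow 2).const_mul (L / 2 * ‖y - x‖ ^ 2)
    refine ((h1.sub h2).sub h3).congr_deriv ?_
    simp
  have hanti : AntitoneOn h (Set.Icc 0 1) := by
    refine antitoneOn_of_deriv_nonpos (convex_Icc _ _)
      (fun t _ => (hd t).continuousAt.continuousWithinAt)
      (fun t _ => (hd t).differentiableAt.differentiableWithinAt) fun t ht => ?_
    rw [interior_Icc] at ht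
    rw [(hd t).deriv, ← inner_sub_left]
    have h1 := real_inner_le_norm (G (x + t • (y - x)) - G x) (y - x)
    have h2 := hG (x + t • (y - x)) x
    rw [add_sub_cancel_left, norm_smul, Real.norm_of_nonneg ht.1.le] at h2
    nlinarith [mul_le_mul_of_nonneg_right h2 (norm_nonneg (y - x))]
  have := hanti (Set.left_mem_Icc.2 zero_le_one) (Set.right_mem_Icc.2 zero_le_one) zero_le_one
  simp only [hh, one_smul, zero_smul, add_zero, add_sub_cancel] at this
  linarith

/-- Descent of `F` along a step of length `η ≤ 1 / L` in a convex combination of two directions. -/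
lemma descent_step [CompleteSpace E] {F : E → ℝ} {G : E → E} {L : ℝ}
    (hF : ∀ x, HasGradientAt F (G x) x) (hG : ∀ x y, ‖G x - G y‖ ≤ L * ‖x - y‖)
    {x y M M' : E} {η β : ℝ} (hβ0 : 0 ≤ β) (hβ1 : β ≤ 1) (hη : 0 ≤ η) (hηL : η * L ≤ 1)
    (hy : y = x - η • (β • M + (1 - β) • M')) :
    F y ≤ F x - η / 2 * ‖G x‖ ^ 2
      + η / 2 * (β * ‖M - G x‖ ^ 2 + (1 - β) * ‖M' - G x‖ ^ 2) := by
  set D := β • M + (1 - β) • M' with hD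
  have hq := le_quadratic_of_lipschitz_gradient hF hG x y
  have hyx : y - x = -(η • D) := by rw [hy]; abel
  rw [hyx, inner_neg_right, inner_smul_right, norm_neg, norm_smul, Real.norm_of_nonneg hη] at hq
  have hconv : ‖D - G x‖ ^ 2 ≤ β * ‖M - G x‖ ^ 2 + (1 - β) * ‖M' - G x‖ ^ 2 := by
    have : D - G x = β • (M - G x) + (1 - β) • (M' - G x) := by rw [hD]; module
    rw [this]
    exact norm_convex_comb_sq_le _ _ hβ0 hβ1
  have hexp := norm_sub_sq_real D (G x)
  rw [real_inner_comm] at hexp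
  nlinarith [mul_le_mul_of_nonneg_left hconv hη,
    mul_nonneg (mul_nonneg hη (sub_nonneg.2 hηL)) (sq_nonneg ‖D‖)]

end SMG

/-- The one-step inequality between consecutive momentum errors and squared gradient norms that
makes the Lyapunov argument work. -/
lemma momentum_error_step {s x V a b b' H H' q μ : ℝ} (hs0 : 0 < s) (hs1 : s ≤ 1) (hx : 0 ≤ x)
    (hV : 1 ≤ V) (hxV : x * (9 * (2 + 3 * s) * V) ≤ s) (ha : 0 ≤ a) (hb : 0 ≤ b) (hb' : 0 ≤ b')
    (hH : 0 ≤ H) (hH' : 0 ≤ H') (hq : 0 ≤ q) (hμ : μ ≤ 2 * b + 2 * H)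
    (hA : a ≤ x * ((1 - s) * μ + 3 * s * (a + V * H + q)))
    (hB : b' ≤ x * ((1 - s) * μ + 3 * s * (b' + V * H' + q))) :
    (1 - s) * b + s * a + (1 - 3 / 4 * s) * b' + (1 - 3 / 4 * s) * H + s / 2 * H
      ≤ H + (1 - 3 / 4 * s) * b + 9 / 2 * (2 + 3 * s) * x * q + (1 - 3 / 4 * s) * H' := by
  have hxV45 : 45 * (x * V) ≤ 1 := by
    by_contra! h
    nlinarith [mul_lt_mul_of_pos_right h (show 0 < 2 + 3 * s by linarith)]
  have hxxV : x ≤ x * V := le_mul_of_one_le_right hx hV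
  have h18 : 18 * x ≤ s := by nlinarith [mul_nonneg (hx.trans hxxV) hs0.le]
  have hxq : 0 ≤ x * q := mul_nonneg hx hq
  have hbH : 0 ≤ b + H := by linarith
  have hμx : x * ((1 - s) * μ) ≤ s / 9 * (b + H) := by
    calc x * ((1 - s) * μ) ≤ x * ((1 - s) * (2 * b + 2 * H)) := by
          have : 0 ≤ 1 - s := by linarith
          gcongr
      _ ≤ x * (1 * (2 * b + 2 * H)) := by
          have : 0 ≤ 2 * b + 2 * H := by linarith
          gcongr; linarith
      _ ≤ s / 9 * (b + H) := by nlinarith [mul_le_mul_of_nonneg_right h18 hbH]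
  have key : ∀ e K : ℝ, 0 ≤ e → 0 ≤ K → e ≤ x * ((1 - s) * μ + 3 * s * (e + V * K + q)) →
      14 / 15 * e ≤ s / 9 * (b + H) + s / 15 * K + 3 * s * (x * q) := by
    intro e K he hK h
    have h1 : s * e * x ≤ e / 45 := by
      nlinarith [mul_le_mul hs1 (show x ≤ 1 / 45 by linarith) hx zero_le_one]
    have h2 : s * K * (x * V) ≤ s * K * (1 / 45) := by gcongr; linarith
    nlinarith
  have kA := key a H ha hH hA
  have kB := key b' H' hb' hH' hB
  have hc0 : 0 ≤ 1 - 3 / 4 * s := by linarith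
  have kA' := mul_le_mul_of_nonneg_left kA hs0.le
  have kB' := mul_le_mul_of_nonneg_left kB hc0
  have e1 : 0 ≤ s * (1 - s) * (b + H) := by
    have : 0 ≤ 1 - s := by linarith
    positivity
  have e2 : s * (s * H) ≤ 1 * (s * H) := by gcongr
  have e3 : (1 - 3 / 4 * s) * (s * H') ≤ (1 - 3 / 4 * s) * (1 * H') := by gcongr
  have e4 : s * (s * (x * q)) ≤ 1 * (s * (x * q)) := by gcongr
  have e5 : s * (x * q) ≤ 1 * (x * q) := by gcongr
  have e6 : 0 ≤ s * (s * (x * q)) := by positivity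
  have e7 : 0 ≤ s * (x * q) := by positivity
  have e8 : 0 ≤ (1 - 3 / 4 * s) * H' := by positivity
  have e9 : 0 ≤ s * b := by positivity
  have e10 : 0 ≤ s * H := by positivity
  linarith

/-- Telescoped descent over `T` epochs. The sequence `x` is the trajectory of epoch endpoints and
`M t` the averaged gradient of epoch `t`, with `M 0 = 0`. -/
lemma sum_gradient_sq_le {E : Type*} [NormedAddCommGroup E] [InnerProductSpace ℝ E]
    [CompleteSpace E] {F : E → ℝ} {G : E → E} {L η s Θ σ : ℝ} {x M : ℕ → E} {T : ℕ}
    (hF : ∀ y, HasGradientAt F (G y) y) (hG : ∀ y z, ‖G y - G z‖ ≤ L * ‖y - z‖)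
    (hs0 : 0 < s) (hs1 : s ≤ 1) (hη : 0 ≤ η) (hηL : η * L ≤ 1) (hΘ : 0 ≤ Θ)
    (hstep : η ^ 2 * L ^ 2 * (9 * (2 + 3 * s) * (Θ + 1)) ≤ s) (hM0 : M 0 = 0)
    (hx : ∀ t < T, x (t + 1) = x t - η • ((1 - s) • M t + s • M (t + 1)))
    (herr : ∀ t < T, ∀ r, r = x t ∨ r = x (t + 1) →
      ∃ b, 0 ≤ b ∧ ‖M (t + 1) - G r‖ ^ 2 ≤ b ∧ b ≤ η ^ 2 * L ^ 2 *
        ((1 - s) * ‖M t‖ ^ 2 + 3 * s * (b + (Θ * ‖G r‖ ^ 2 + σ ^ 2) + ‖G r‖ ^ 2))) :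
    F (x T) + η * s / 4 * ∑ t ∈ range T, ‖G (x t)‖ ^ 2
      ≤ F (x 0) + T * (9 / 4 * (2 + 3 * s) * (η ^ 2 * L ^ 2) * η * σ ^ 2) := by
  set c := 1 - 3 / 4 * s with hc
  set C := 9 / 4 * (2 + 3 * s) * (η ^ 2 * L ^ 2) * η * σ ^ 2 with hC
  have hc0 : 0 ≤ c := by linarith
  -- one epoch, with `e` and `h` standing for the next momentum error and squared gradient
  have hone : ∀ t < T, ∀ e h, 0 ≤ e → 0 ≤ h →
      e ≤ η ^ 2 * L ^ 2 * ((1 - s) * ‖M t‖ ^ 2 + 3 * s * (e + (Θ + 1) * h + σ ^ 2)) →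
      F (x (t + 1)) + η / 2 * c * e + η / 2 * c * ‖G (x t)‖ ^ 2 + η * s / 4 * ‖G (x t)‖ ^ 2
        ≤ F (x t) + η / 2 * c * ‖M t - G (x t)‖ ^ 2 + C + η / 2 * c * h := by
    intro t ht e h he hh heh
    obtain ⟨a, ha0, haM, ha⟩ := herr t ht (x t) (Or.inl rfl)
    have hμ : ‖M t‖ ^ 2 ≤ 2 * ‖M t - G (x t)‖ ^ 2 + 2 * ‖G (x t)‖ ^ 2 := by
      have h1 := norm_add_le (M t - G (x t)) (G (x t))
      rw [sub_add_cancel] at h1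
      nlinarith [pow_le_pow_left₀ (norm_nonneg _) h1 2,
        sq_nonneg (‖M t - G (x t)‖ - ‖G (x t)‖)]
    have hkey := momentum_error_step (V := Θ + 1) hs0 hs1 (by positivity) (by linarith) hstep
      ha0 (sq_nonneg ‖M t - G (x t)‖) he (sq_nonneg ‖G (x t)‖) hh (sq_nonneg σ) hμ
      (ha.trans_eq (by ring)) heh
    have hdesc := descent_step hF hG (β := 1 - s) (by linarith) (by linarith) hη hηL
      (x := x t) (y := x (t + 1)) (M := M t) (M' := M (t + 1)) (by rw [hx t ht, sub_sub_cancel])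
    rw [sub_sub_cancel] at hdesc
    have hkey' := mul_le_mul_of_nonneg_left hkey (show 0 ≤ η / 2 by linarith)
    have haM' := mul_le_mul_of_nonneg_left (mul_le_mul_of_nonneg_left haM hs0.le)
      (show 0 ≤ η / 2 by linarith)
    rw [hC, hc]
    linarith
  have hind : ∀ t ≤ T, F (x t) + η / 2 * c * ‖M t - G (x t)‖ ^ 2
      + η * s / 4 * ∑ k ∈ range t, ‖G (x k)‖ ^ 2
        ≤ F (x 0) + t * C + η / 2 * c * ‖G (x t)‖ ^ 2 := by
    intro t
    induction t with
    | zero => intro _; simp [hM0]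
    | succ k ih =>
      intro hk
      obtain ⟨b, hb0, hbM, hb⟩ := herr k hk (x (k + 1)) (Or.inr rfl)
      have h1 := hone k hk b _ hb0 (sq_nonneg ‖G (x (k + 1))‖) (hb.trans_eq (by ring))
      have h2 := ih (Nat.le_of_succ_le hk)
      have h3 := mul_le_mul_of_nonneg_left hbM (show 0 ≤ η / 2 * c by positivity)
      rw [sum_range_succ]
      push_cast
      linarith
  cases T with
  | zero => simp
  | succ k =>
    have h1 := hone k k.lt_succ_self 0 0 le_rfl le_rfl (by
      have : 0 ≤ 1 - s := by linarith
      positivity)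
    have h2 := hind k k.le_succ
    rw [sum_range_succ]
    push_cast
    linarith

lemma hasGradientAt_average {E : Type*} [NormedAddCommGroup E] [InnerProductSpace ℝ E]
    [CompleteSpace E] {ι : Type*} [Fintype ι] {f : ι → E → ℝ} (hf : ∀ i, Differentiable ℝ (f i))
    (c : ℝ) (x : E) :
    HasGradientAt (fun y => c * ∑ i, f i y) (c • ∑ i, gradient (f i) x) x := by
  rw [hasGradientAt_iff_hasFDerivAt, map_smul, map_sum]
  exact (HasFDerivAt.fun_sum fun i _ => (hf i x).hasGradientAt.hasFDerivAt).const_mul c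

theorem smg_constant_lr
    (n d : ℕ) (hn : 1 ≤ n) (hd : 1 ≤ d)
    (f : Fin n → EuclideanSpace ℝ (Fin d) → ℝ)
    (hf : ∀ i, Differentiable ℝ (f i))
    (F : EuclideanSpace ℝ (Fin d) → ℝ)
    (hF : F = fun x => (1 / (n : ℝ)) * ∑ i, f i x)
    (L : ℝ) (hL : 0 < L)
    (hsmooth : ∀ i x y, ‖gradient (f i) x - gradient (f i) y‖ ≤ L * ‖x - y‖)
    (Θ σ : ℝ) (hΘ : 0 ≤ Θ) (hσ : 0 ≤ σ)
    (hvar : ∀ x, (1 / (n : ℝ)) * ∑ i, ‖gradient (f i) x - gradient F x‖ ^ 2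
        ≤ Θ * ‖gradient F x‖ ^ 2 + σ ^ 2)
    (Fstar : ℝ) (hFstar : IsGLB (Set.range F) Fstar)
    (T : ℕ) (hT : 1 ≤ T)
    (β : ℝ) (hβ0 : 0 ≤ β) (hβ1 : β < 1)
    (η : ℕ → ℝ) (hηpos : ∀ t, 1 ≤ t → t ≤ T → 0 < η t)
    (π : ℕ → Equiv.Perm (Fin n))
    (w m v g : ℕ → ℕ → EuclideanSpace ℝ (Fin d))
    (wt mt : ℕ → EuclideanSpace ℝ (Fin d))
    (hmt0 : mt 0 = 0)
    (hw0 : ∀ t, 1 ≤ t → t ≤ T → w t 0 = wt (t - 1))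
    (hm0 : ∀ t, 1 ≤ t → t ≤ T → m t 0 = mt (t - 1))
    (hv0 : ∀ t, 1 ≤ t → t ≤ T → v t 0 = 0)
    (hg : ∀ t, 1 ≤ t → t ≤ T → ∀ i, ∀ hi : i < n,
        g t i = gradient (f (π t ⟨i, hi⟩)) (w t i))
    (hm1 : ∀ t, 1 ≤ t → t ≤ T → ∀ i, i < n →
        m t (i + 1) = β • m t 0 + (1 - β) • g t i)
    (hv1 : ∀ t, 1 ≤ t → t ≤ T → ∀ i, i < n →
        v t (i + 1) = v t i + ((n : ℝ))⁻¹ • g t i)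
    (hw1 : ∀ t, 1 ≤ t → t ≤ T → ∀ i, i < n →
        w t (i + 1) = w t i - (η t / (n : ℝ)) • m t (i + 1))
    (hwt : ∀ t, 1 ≤ t → t ≤ T → wt t = w t n)
    (hmt : ∀ t, 1 ≤ t → t ≤ T → mt t = v t n)
    (K : ℝ) (hKdef : K = max (5 / 2) (9 * (5 - 3 * β) * (Θ + 1) / (1 - β)))
    (γ : ℝ) (hγ : 0 < γ)
    (hη : ∀ t, η t = γ / (T : ℝ) ^ ((1 : ℝ) / 3))
    (hηK : γ / (T : ℝ) ^ ((1 : ℝ) / 3) ≤ 1 / (L * Real.sqrt K)) :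
    (∑ t ∈ Icc 1 T, η t * ‖gradient F (wt (t - 1))‖ ^ 2) / (∑ t ∈ Icc 1 T, η t)
      ≤ (1 / (T : ℝ) ^ ((2 : ℝ) / 3))
          * (4 * (F (wt 0) - Fstar) / ((1 - β) * γ)
            + 9 * σ ^ 2 * (5 - 3 * β) * L ^ 2 * γ ^ 2 / (1 - β)) := by
  have hnpos : (0 : ℝ) < n := by exact_mod_cast hn
  have hTpos : (0 : ℝ) < T := by exact_mod_cast hT
  have hs0 : 0 < 1 - β := by linarith
  set h := γ / (T : ℝ) ^ ((1 : ℝ) / 3) with hh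
  have hhpos : 0 < h := by positivity
  have hgradF : ∀ x, HasGradientAt F (gradient F x) x := by
    intro x
    have hx := hasGradientAt_average hf (1 / (n : ℝ)) x
    rw [← hF] at hx
    exact hx.differentiableAt.hasGradientAt
  have hgradF_eq : ∀ x, gradient F x = (n : ℝ)⁻¹ • ∑ i, gradient (f i) x := by
    intro x
    rw [hF, (hasGradientAt_average hf (1 / (n : ℝ)) x).gradient, one_div]
  have hlipF : ∀ x y, ‖gradient F x - gradient F y‖ ≤ L * ‖x - y‖ := by
    intro x y
    rw [hgradF_eq, hgradF_eq, ← smul_sub, ← sum_sub_distrib, norm_smul,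
      Real.norm_of_nonneg (by positivity), inv_mul_le_iff₀ hnpos]
    refine (norm_sum_le _ _).trans ((sum_le_sum fun i _ => hsmooth i x y).trans_eq ?_)
    simp
  -- the step-size condition
  have hKpos : 0 < K := by rw [hKdef]; positivity
  have hhK : (h * L) ^ 2 * K ≤ 1 := by
    have hsq : 0 < √K := Real.sqrt_pos.2 hKpos
    have h1 : h * L * √K ≤ 1 := by
      rw [le_div_iff₀ (by positivity)] at hηK
      linarith
    calc (h * L) ^ 2 * K = (h * L * √K) ^ 2 := by rw [mul_pow _ (√K), Real.sq_sqrt hKpos.le]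
      _ ≤ 1 := pow_le_one₀ (by positivity) h1
  have hhL : h * L ≤ 1 := by
    have : 5 / 2 ≤ K := hKdef ▸ le_max_left _ _
    nlinarith [mul_le_mul_of_nonneg_left this (sq_nonneg (h * L)), mul_pos hhpos hL]
  have hstep : h ^ 2 * L ^ 2 * (9 * (2 + 3 * (1 - β)) * (Θ + 1)) ≤ 1 - β := by
    have h1 : 9 * (5 - 3 * β) * (Θ + 1) / (1 - β) ≤ K := hKdef ▸ le_max_right _ _
    have h2 := (mul_le_mul_of_nonneg_left h1 (sq_nonneg (h * L))).trans hhK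
    rw [← mul_div_assoc, div_le_one hs0] at h2
    linarith
  -- one epoch
  have hepoch : ∀ t < T,
      wt (t + 1) = wt t - h • ((1 - (1 - β)) • mt t + (1 - β) • mt (t + 1)) ∧
      ∀ r, r = wt t ∨ r = wt (t + 1) →
        ∃ b, 0 ≤ b ∧ ‖mt (t + 1) - gradient F r‖ ^ 2 ≤ b ∧ b ≤ h ^ 2 * L ^ 2 *
          ((1 - (1 - β)) * ‖mt t‖ ^ 2 + 3 * (1 - β) *
            (b + (Θ * ‖gradient F r‖ ^ 2 + σ ^ 2) + ‖gradient F r‖ ^ 2)) := by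
    intro t ht
    have h1 : 1 ≤ t + 1 := Nat.le_add_left 1 t
    set φ : ℕ → EuclideanSpace ℝ (Fin d) → EuclideanSpace ℝ (Fin d) :=
      fun j => if hj : j < n then gradient (f (π (t + 1) ⟨j, hj⟩)) else 0 with hφ
    have hφ_fin : ∀ i : Fin n, φ i = gradient (f (π (t + 1) i)) := fun i => by simp [hφ]
    have hgφ : ∀ i < n, g (t + 1) i = φ i (w (t + 1) i) := fun i hi => by
      rw [hg (t + 1) h1 ht i hi, ← hφ_fin ⟨i, hi⟩]
    have hvsum : ∀ i ≤ n, v (t + 1) i = (n : ℝ)⁻¹ • ∑ j ∈ range i, φ j (w (t + 1) j) := by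
      intro i
      induction i with
      | zero => intro _; simp [hv0 (t + 1) h1 ht]
      | succ k ih =>
        intro hk
        rw [hv1 (t + 1) h1 ht k hk, ih (Nat.le_of_succ_le hk), sum_range_succ, smul_add, hgφ k hk]
    have key := epoch_estimates hn (φ := φ) (G := gradient F) (u := w (t + 1)) (M := mt t)
      (M' := mt (t + 1)) (L := L) (Θ := Θ) (σ := σ) hβ0 hβ1.le hhpos.le
      (fun j hj x y => by
        rw [hφ_fin ⟨j, hj⟩]
        exact hsmooth _ x y)
      (fun x => by
        rw [hgradF_eq, sum_range]
        simp only [hφ_fin]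
        rw [Equiv.sum_comp (π (t + 1)) fun i => gradient (f i) x])
      (fun x => by
        rw [sum_range]
        simp only [hφ_fin]
        rw [Equiv.sum_comp (π (t + 1)) fun i => ‖gradient (f i) x - gradient F x‖ ^ 2, ← one_div]
        exact hvar x)
      (fun i hi => by
        rw [hw1 (t + 1) h1 ht i hi, hm1 (t + 1) h1 ht i hi, hm0 (t + 1) h1 ht, hgφ i hi, hη,
          Nat.add_sub_cancel])
      (by rw [hmt (t + 1) h1 ht, hvsum n le_rfl])
    rw [hw0 (t + 1) h1 ht, ← hwt (t + 1) h1 ht, Nat.add_sub_cancel] at key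
    rwa [sub_sub_cancel]
  have hmain := sum_gradient_sq_le hgradF hlipF hs0 (by linarith) hhpos.le hhL hΘ hstep hmt0
    (fun t ht => (hepoch t ht).1) (fun t ht => (hepoch t ht).2)
  have hlow : Fstar ≤ F (wt T) := hFstar.1 ⟨_, rfl⟩
  have hsum : ∑ t ∈ Icc 1 T, η t * ‖gradient F (wt (t - 1))‖ ^ 2
      = h * ∑ t ∈ range T, ‖gradient F (wt t)‖ ^ 2 := by
    rw [mul_sum, ← Finset.Ico_add_one_right_eq_Icc, sum_Ico_eq_sum_range]
    simp [hη]
  have hden : ∑ t ∈ Icc 1 T, η t = T * h := by simp [hη]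
  have hT3 : 0 < (T : ℝ) ^ ((1 : ℝ) / 3) := by positivity
  have hT2 : (T : ℝ) ^ ((2 : ℝ) / 3) = ((T : ℝ) ^ ((1 : ℝ) / 3)) ^ 2 := by
    rw [← Real.rpow_natCast, ← Real.rpow_mul hTpos.le]; norm_num
  have hT1 : (T : ℝ) = ((T : ℝ) ^ ((1 : ℝ) / 3)) ^ 3 := by
    rw [← Real.rpow_natCast, ← Real.rpow_mul hTpos.le]; norm_num
  have hrhs : (1 / (T : ℝ) ^ ((2 : ℝ) / 3)) * (4 * (F (wt 0) - Fstar) / ((1 - β) * γ)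
      + 9 * σ ^ 2 * (5 - 3 * β) * L ^ 2 * γ ^ 2 / (1 - β))
      = (4 * (F (wt 0) - Fstar) / (1 - β)
        + T * (9 * σ ^ 2 * (5 - 3 * β) * L ^ 2 * h ^ 3 / (1 - β))) / (T * h) := by
    have hγh : γ = h * (T : ℝ) ^ ((1 : ℝ) / 3) := by rw [hh]; field_simp
    rw [hT2, hγh]
    generalize (T : ℝ) ^ ((1 : ℝ) / 3) = q at hT3 hT1
    rw [hT1]
    field_simp
  rw [hsum, hden, hrhs]
  gcongr
  rw [← mul_div_assoc, ← add_div, le_div_iff₀ hs0]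
  linarith
end

section
/- For the SMG iterates with arbitrary permutations and β ∈ [0,1), the following bounds hold for every i = 0,1,…,n. (a) If t > 1 then ‖w_i^(t) − w_0^(t)‖² ≤ (ξ_t²/n²)·[ β·(i²/n²)·A_n^(t−1) + (1−β)·A_i^(t) ], and if t = 1 then ‖w_i^(1) − w_0^(1)‖² ≤ (ξ_1²/n²)·(1−β)²·A_i^(1). (b) If t > 2 then ‖w_i^(t−1) − w_0^(t)‖² ≤ (ξ_t²/n²)·[ β·((n−i)²/n²)·A_n^(t−2) + (1−β)·B_i^(t−1) ], and if t = 2 then ‖w_i^(1) − w_0^(2)‖² ≤ (ξ_2²/n²)·(1−β)²·B_i^(1). -/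
open Finset

variable {E : Type*} [NormedAddCommGroup E] [NormedSpace ℝ E]

/-- Displacement between two inner iterates of one epoch. -/
theorem epoch_displacement {n : ℕ} {β γ : ℝ} {w m g : ℕ → E}
    (hm : ∀ i < n, m (i + 1) = β • m 0 + (1 - β) • g i)
    (hw : ∀ i < n, w (i + 1) = w i - γ • m (i + 1)) {i k : ℕ} (hik : i ≤ k) (hk : k ≤ n) :
    w i - w k = γ • (β • (((k : ℝ) - i) • m 0) + (1 - β) • ∑ j ∈ Ico i k, g j) := by
  induction k, hik using Nat.le_induction with
  | base => simp
  | succ k hik ih =>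
    have hlt : k < n := hk
    rw [hw k hlt, sub_sub_eq_add_sub, add_sub_right_comm, ih hlt.le, hm k hlt,
      sum_Ico_succ_top hik]
    push_cast
    module

/-- The averaged gradients accumulated over an epoch. -/
theorem epoch_average {n : ℕ} {c : ℝ} {v g : ℕ → E} (hv0 : v 0 = 0)
    (hv : ∀ i < n, v (i + 1) = v i + c • g i) : v n = c • ∑ j ∈ range n, g j := by
  suffices h : ∀ k ≤ n, v k = c • ∑ j ∈ range k, g j from h n le_rfl
  intro k hk
  induction k with
  | zero => simp [hv0]
  | succ k ih => rw [hv k hk, ih (Nat.le_of_succ_le hk), sum_range_succ, smul_add]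

theorem norm_sq_convex_combination_le {β : ℝ} (hβ0 : 0 ≤ β) (hβ1 : β ≤ 1) (x y : E) :
    ‖β • x + (1 - β) • y‖ ^ 2 ≤ β * ‖x‖ ^ 2 + (1 - β) * ‖y‖ ^ 2 := by
  have h : ‖β • x + (1 - β) • y‖ ≤ β * ‖x‖ + (1 - β) * ‖y‖ := by
    refine (norm_add_le _ _).trans_eq ?_
    rw [norm_smul_of_nonneg hβ0, norm_smul_of_nonneg (sub_nonneg.2 hβ1)]
  refine (pow_le_pow_left₀ (norm_nonneg _) h 2).trans ?_
  nlinarith [mul_nonneg (mul_nonneg hβ0 (sub_nonneg.2 hβ1)) (sq_nonneg (‖x‖ - ‖y‖))]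

theorem norm_sq_div_smul_le {η ξ a : ℝ} (hη : 0 ≤ η) (hηξ : η ≤ ξ) (n : ℕ) {x : E}
    (hx : ‖x‖ ^ 2 ≤ a) : ‖(η / n) • x‖ ^ 2 ≤ ξ ^ 2 / (n : ℝ) ^ 2 * a := by
  rw [norm_smul, mul_pow, Real.norm_eq_abs, sq_abs, div_pow]
  gcongr

theorem smg_lemma1
    (n d : ℕ) (hn : 1 ≤ n) (hd : 1 ≤ d)
    (f : Fin n → EuclideanSpace ℝ (Fin d) → ℝ)
    (hf : ∀ i, Differentiable ℝ (f i))
    (F : EuclideanSpace ℝ (Fin d) → ℝ)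
    (hF : F = fun x => (1 / (n : ℝ)) * ∑ i, f i x)
    (T : ℕ) (hT : 1 ≤ T)
    (β : ℝ) (hβ0 : 0 ≤ β) (hβ1 : β < 1)
    (η : ℕ → ℝ) (hηpos : ∀ t, 1 ≤ t → t ≤ T → 0 < η t)
    (π : ℕ → Equiv.Perm (Fin n))
    (w m v g : ℕ → ℕ → EuclideanSpace ℝ (Fin d))
    (wt mt : ℕ → EuclideanSpace ℝ (Fin d))
    (hmt0 : mt 0 = 0)
    (hw0 : ∀ t, 1 ≤ t → t ≤ T → w t 0 = wt (t - 1))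
    (hm0 : ∀ t, 1 ≤ t → t ≤ T → m t 0 = mt (t - 1))
    (hv0 : ∀ t, 1 ≤ t → t ≤ T → v t 0 = 0)
    (hg : ∀ t, 1 ≤ t → t ≤ T → ∀ i, ∀ hi : i < n,
        g t i = gradient (f (π t ⟨i, hi⟩)) (w t i))
    (hm1 : ∀ t, 1 ≤ t → t ≤ T → ∀ i, i < n →
        m t (i + 1) = β • m t 0 + (1 - β) • g t i)
    (hv1 : ∀ t, 1 ≤ t → t ≤ T → ∀ i, i < n →
        v t (i + 1) = v t i + ((n : ℝ))⁻¹ • g t i)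
    (hw1 : ∀ t, 1 ≤ t → t ≤ T → ∀ i, i < n →
        w t (i + 1) = w t i - (η t / (n : ℝ)) • m t (i + 1))
    (hwt : ∀ t, 1 ≤ t → t ≤ T → wt t = w t n)
    (hmt : ∀ t, 1 ≤ t → t ≤ T → mt t = v t n)
    (ξ : ℕ → ℝ) (hξ1 : ξ 1 = η 1) (hξ : ∀ t, 2 ≤ t → ξ t = max (η t) (η (t - 1)))
    (A B : ℕ → ℕ → ℝ)
    (hA : ∀ t i, A t i = ‖∑ j ∈ range i, g t j‖ ^ 2)
    (hB : ∀ t i, B t i = ‖∑ j ∈ Ico i n, g t j‖ ^ 2)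
    :
    (∀ t, 2 ≤ t → t ≤ T → ∀ i ≤ n,
        ‖w t i - w t 0‖ ^ 2 ≤ ξ t ^ 2 / (n : ℝ) ^ 2 *
          (β * ((i : ℝ) ^ 2 / (n : ℝ) ^ 2) * A (t - 1) n + (1 - β) * A t i)) ∧
    (∀ i ≤ n,
        ‖w 1 i - w 1 0‖ ^ 2 ≤ ξ 1 ^ 2 / (n : ℝ) ^ 2 * ((1 - β) ^ 2 * A 1 i)) ∧
    (∀ t, 3 ≤ t → t ≤ T → ∀ i ≤ n,
        ‖w (t - 1) i - w t 0‖ ^ 2 ≤ ξ t ^ 2 / (n : ℝ) ^ 2 *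
          (β * (((n : ℝ) - (i : ℝ)) ^ 2 / (n : ℝ) ^ 2) * A (t - 2) n
            + (1 - β) * B (t - 1) i)) ∧
    (2 ≤ T → ∀ i ≤ n,
        ‖w 1 i - w 2 0‖ ^ 2 ≤ ξ 2 ^ 2 / (n : ℝ) ^ 2 * ((1 - β) ^ 2 * B 1 i)) := by
  have momentum_first : m 1 0 = 0 := by rw [hm0 1 le_rfl hT, hmt0]
  have momentum_next : ∀ t, 1 ≤ t → t + 1 ≤ T →
      m (t + 1) 0 = (n : ℝ)⁻¹ • ∑ j ∈ range n, g t j := by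
    intro t ht htT
    have htT' : t ≤ T := Nat.le_of_succ_le htT
    rw [hm0 (t + 1) (Nat.le_add_left 1 t) htT, Nat.add_sub_cancel, hmt t ht htT']
    exact epoch_average (hv0 t ht htT') (hv1 t ht htT')
  have start_next : ∀ t, 1 ≤ t → t + 1 ≤ T → w (t + 1) 0 = w t n := by
    intro t ht htT
    rw [hw0 (t + 1) (Nat.le_add_left 1 t) htT, Nat.add_sub_cancel,
      hwt t ht (Nat.le_of_succ_le htT)]
  have bound_first : ∀ x, η 1 ≤ x → ∀ i k, i ≤ k → k ≤ n →
      ‖w 1 i - w 1 k‖ ^ 2 ≤ x ^ 2 / (n : ℝ) ^ 2 *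
        ((1 - β) ^ 2 * ‖∑ j ∈ Ico i k, g 1 j‖ ^ 2) := by
    intro x hx i k hik hk
    rw [epoch_displacement (hm1 1 le_rfl hT) (hw1 1 le_rfl hT) hik hk, momentum_first]
    refine norm_sq_div_smul_le (hηpos 1 le_rfl hT).le hx n (le_of_eq ?_)
    rw [smul_zero, smul_zero, zero_add, norm_smul, mul_pow, Real.norm_eq_abs, sq_abs]
  have bound_next : ∀ t, 1 ≤ t → t + 1 ≤ T → ∀ x, η (t + 1) ≤ x → ∀ i k, i ≤ k → k ≤ n →
      ‖w (t + 1) i - w (t + 1) k‖ ^ 2 ≤ x ^ 2 / (n : ℝ) ^ 2 *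
        (β * (((k : ℝ) - i) ^ 2 / (n : ℝ) ^ 2) * ‖∑ j ∈ range n, g t j‖ ^ 2
          + (1 - β) * ‖∑ j ∈ Ico i k, g (t + 1) j‖ ^ 2) := by
    intro t ht htT x hx i k hik hk
    have ht' : 1 ≤ t + 1 := Nat.le_add_left 1 t
    rw [epoch_displacement (hm1 _ ht' htT) (hw1 _ ht' htT) hik hk, momentum_next t ht htT]
    refine norm_sq_div_smul_le (hηpos _ ht' htT).le hx n
      ((norm_sq_convex_combination_le hβ0 hβ1.le _ _).trans_eq ?_)
    rw [smul_smul, ← div_eq_mul_inv, norm_smul, mul_pow, Real.norm_eq_abs, sq_abs, div_pow,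
      mul_assoc]
  refine ⟨fun t ht htT i hi => ?_, fun i hi => ?_, fun t ht htT i hi => ?_, fun hT2 i hi => ?_⟩
  · obtain ⟨s, rfl⟩ := Nat.exists_eq_add_of_le' (show 1 ≤ t by omega)
    have h := bound_next s (by omega) htT (ξ (s + 1)) ((hξ _ ht).symm ▸ le_max_left _ _)
      0 i (Nat.zero_le i) hi
    rwa [norm_sub_rev, Nat.cast_zero, sub_zero, ← range_eq_Ico, ← hA, ← hA] at h
  · have h := bound_first (ξ 1) hξ1.ge 0 i (Nat.zero_le i) hi
    rwa [norm_sub_rev, ← range_eq_Ico, ← hA] at h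
  · obtain ⟨s, rfl⟩ := Nat.exists_eq_add_of_le' (show 2 ≤ t by omega)
    have h := bound_next s (by omega) (by omega) (ξ (s + 2))
      ((hξ (s + 2) (by omega)).symm ▸ le_max_right _ _) i n hi le_rfl
    rwa [← start_next (s + 1) (by omega) htT, ← hA, ← hB] at h
  · have h := bound_first (ξ 2) ((hξ 2 le_rfl).symm ▸ le_max_right _ _) i n hi le_rfl
    rwa [← start_next 1 le_rfl hT2, ← hB] at h
end

section
/- For the SMG iterates with arbitrary permutations, under the generalized bounded variance assumption (c), for every t ∈ {1,…,T}: (a) A_n^(t) ≤ 3·n·(I_t + K_t) and Σ_{i=0}^{n−1} A_i^(t) ≤ (3·n²/2)·(I_t + K_t); (b) Σ_{i=0}^{n−1} B_i^(t) ≤ 3·n²·(I_t + K_t). -/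
open Finset

/-- Cauchy–Schwarz for the norm of a finite sum. -/
lemma norm_sum_sq_le_card_mul_sum_sq {ι E : Type*} [SeminormedAddCommGroup E]
    (s : Finset ι) (a : ι → E) : ‖∑ j ∈ s, a j‖ ^ 2 ≤ #s * ∑ j ∈ s, ‖a j‖ ^ 2 :=
  (pow_le_pow_left₀ (norm_nonneg _) (norm_sum_le s a) 2).trans sq_sum_le_card_mul_sum_sq

/-- A vector `a` is compared with a reference vector `c` through an intermediate vector `b`. -/
lemma norm_sq_le_three_mul_add {E : Type*} [SeminormedAddCommGroup E] (a b c : E) :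
    ‖a‖ ^ 2 ≤ 3 * (‖b - a‖ ^ 2 + ‖b - c‖ ^ 2 + ‖c‖ ^ 2) := by
  have h : ‖a‖ ≤ ‖b - a‖ + ‖b - c‖ + ‖c‖ := by
    calc ‖a‖ = ‖(b - c) - (b - a) + c‖ := by congr 1; abel
      _ ≤ ‖b - c‖ + ‖b - a‖ + ‖c‖ :=
        (norm_add_le _ _).trans (by gcongr; exact norm_sub_le _ _)
      _ = _ := by ring
  nlinarith [norm_nonneg a, sq_nonneg (‖b - a‖ - ‖b - c‖), sq_nonneg (‖b - a‖ - ‖c‖),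
    sq_nonneg (‖b - c‖ - ‖c‖)]

/-- A sum of norm squares is controlled by the deviation from intermediate vectors `b (π i)`,
taken in an arbitrary order `π`, and the spread of these around a centre `c`. -/
lemma sum_norm_sq_le_of_perm {ι E : Type*} [Fintype ι] [SeminormedAddCommGroup E]
    (a b : ι → E) (c : E) (π : Equiv.Perm ι) :
    ∑ i, ‖a i‖ ^ 2 ≤
      3 * (∑ i, ‖b (π i) - a i‖ ^ 2 + ∑ i, ‖b i - c‖ ^ 2 + Fintype.card ι * ‖c‖ ^ 2) := by
  calc ∑ i, ‖a i‖ ^ 2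
      ≤ ∑ i, 3 * (‖b (π i) - a i‖ ^ 2 + ‖b (π i) - c‖ ^ 2 + ‖c‖ ^ 2) :=
        sum_le_sum fun i _ => norm_sq_le_three_mul_add _ _ _
    _ = _ := by
      rw [← mul_sum, sum_add_distrib, sum_add_distrib, π.sum_comp univ (fun i => ‖b i - c‖ ^ 2)
        (by simp)]
      simp

theorem smg_lemma2
    (n d : ℕ) (hn : 1 ≤ n) (hd : 1 ≤ d)
    (f : Fin n → EuclideanSpace ℝ (Fin d) → ℝ)
    (hf : ∀ i, Differentiable ℝ (f i))
    (F : EuclideanSpace ℝ (Fin d) → ℝ)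
    (hF : F = fun x => (1 / (n : ℝ)) * ∑ i, f i x)
    (Θ σ : ℝ) (hΘ : 0 ≤ Θ) (hσ : 0 ≤ σ)
    (hvar : ∀ x, (1 / (n : ℝ)) * ∑ i, ‖gradient (f i) x - gradient F x‖ ^ 2
        ≤ Θ * ‖gradient F x‖ ^ 2 + σ ^ 2)
    (T : ℕ) (hT : 1 ≤ T)
    (β : ℝ) (hβ0 : 0 ≤ β) (hβ1 : β < 1)
    (η : ℕ → ℝ) (hηpos : ∀ t, 1 ≤ t → t ≤ T → 0 < η t)
    (π : ℕ → Equiv.Perm (Fin n))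
    (w m v g : ℕ → ℕ → EuclideanSpace ℝ (Fin d))
    (wt mt : ℕ → EuclideanSpace ℝ (Fin d))
    (hmt0 : mt 0 = 0)
    (hw0 : ∀ t, 1 ≤ t → t ≤ T → w t 0 = wt (t - 1))
    (hm0 : ∀ t, 1 ≤ t → t ≤ T → m t 0 = mt (t - 1))
    (hv0 : ∀ t, 1 ≤ t → t ≤ T → v t 0 = 0)
    (hg : ∀ t, 1 ≤ t → t ≤ T → ∀ i, ∀ hi : i < n,
        g t i = gradient (f (π t ⟨i, hi⟩)) (w t i))
    (hm1 : ∀ t, 1 ≤ t → t ≤ T → ∀ i, i < n →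
        m t (i + 1) = β • m t 0 + (1 - β) • g t i)
    (hv1 : ∀ t, 1 ≤ t → t ≤ T → ∀ i, i < n →
        v t (i + 1) = v t i + ((n : ℝ))⁻¹ • g t i)
    (hw1 : ∀ t, 1 ≤ t → t ≤ T → ∀ i, i < n →
        w t (i + 1) = w t i - (η t / (n : ℝ)) • m t (i + 1))
    (hwt : ∀ t, 1 ≤ t → t ≤ T → wt t = w t n)
    (hmt : ∀ t, 1 ≤ t → t ≤ T → mt t = v t n)
    (A B : ℕ → ℕ → ℝ)
    (hA : ∀ t i, A t i = ‖∑ j ∈ range i, g t j‖ ^ 2)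
    (hB : ∀ t i, B t i = ‖∑ j ∈ Ico i n, g t j‖ ^ 2)
    (I K' : ℕ → ℝ)
    (hI : ∀ t, I t = ∑ i : Fin n, ‖gradient (f (π t i)) (w t 0) - g t (i : ℕ)‖ ^ 2)
    (hK' : ∀ t, K' t = (n : ℝ) * (Θ + 1) * ‖gradient F (w t 0)‖ ^ 2 + (n : ℝ) * σ ^ 2)
    :
    ∀ t, 1 ≤ t → t ≤ T →
      A t n ≤ 3 * (n : ℝ) * (I t + K' t) ∧
      (∑ i ∈ range n, A t i) ≤ 3 * (n : ℝ) ^ 2 / 2 * (I t + K' t) ∧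
      (∑ i ∈ range n, B t i) ≤ 3 * (n : ℝ) ^ 2 * (I t + K' t) := by
  intro t _ _
  have hn0 : (0 : ℝ) < n := by exact_mod_cast hn
  have hV : ∑ i, ‖gradient (f i) (w t 0) - gradient F (w t 0)‖ ^ 2
      ≤ n * (Θ * ‖gradient F (w t 0)‖ ^ 2 + σ ^ 2) := by
    have h := hvar (w t 0)
    rwa [one_div, inv_mul_le_iff₀ hn0] at h
  have hS : ∑ j ∈ range n, ‖g t j‖ ^ 2 ≤ 3 * (I t + K' t) := by
    have h := sum_norm_sq_le_of_perm (fun i : Fin n => g t i)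
      (fun i => gradient (f i) (w t 0)) (gradient F (w t 0)) (π t)
    rw [Fintype.card_fin, ← hI t] at h
    rw [sum_range, hK' t]
    linarith
  have hX : 0 ≤ I t + K' t := by
    linarith [sum_nonneg fun j (_ : j ∈ range n) => sq_nonneg ‖g t j‖]
  have hsub : ∀ s ⊆ range n, ‖∑ j ∈ s, g t j‖ ^ 2 ≤ #s * (3 * (I t + K' t)) := fun s hs =>
    (norm_sum_sq_le_card_mul_sum_sq s (g t)).trans <| by
      gcongr
      exact (sum_le_sum_of_subset_of_nonneg hs fun _ _ _ => sq_nonneg _).trans hS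
  refine ⟨?_, ?_, ?_⟩
  · have h := hsub (range n) subset_rfl
    rw [← hA, card_range] at h
    linarith
  · have hgauss : ∑ i ∈ range n, (i : ℝ) ≤ (n : ℝ) ^ 2 / 2 := by
      have h : ((∑ i ∈ range n, i : ℕ) : ℝ) * 2 = n * (n - 1 : ℕ) := by
        exact_mod_cast sum_range_id_mul_two n
      rw [Nat.cast_sum, Nat.cast_sub hn, Nat.cast_one] at h
      nlinarith
    calc ∑ i ∈ range n, A t i ≤ ∑ i ∈ range n, (i : ℝ) * (3 * (I t + K' t)) := by
          refine sum_le_sum fun i hi => ?_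
          have h := hsub (range i) (range_mono (mem_range.1 hi).le)
          rwa [← hA, card_range] at h
      _ = (∑ i ∈ range n, (i : ℝ)) * (3 * (I t + K' t)) := (sum_mul ..).symm
      _ ≤ (n : ℝ) ^ 2 / 2 * (3 * (I t + K' t)) := by gcongr
      _ = _ := by ring
  · calc ∑ i ∈ range n, B t i ≤ ∑ _i ∈ range n, (n : ℝ) * (3 * (I t + K' t)) := by
          refine sum_le_sum fun i _ => ?_
          have h := hsub (Ico i n) fun j hj => mem_range.2 (mem_Ico.1 hj).2
          rw [← hB, Nat.card_Ico] at h
          refine h.trans ?_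
          gcongr
          exact Nat.sub_le n i
      _ = _ := by rw [sum_const, card_range, nsmul_eq_mul]; ring
end
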